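/- arXiv:1403.2677 — 2 statements merged into one kernel-verified Lean document; each statement's English description precedes it below -/
import Mathlib

section
/- For every fixed real k > 0, k·H_n′(k)/H_n(k) ~ −|n| as |n| → ∞ over integers n; that is, lim_{|n|→∞} ( k·H_n′(k) ) / ( |n|·H_n(k) ) = −1 (and H_n(k) ≠ 0 for all n). -/
open Complex Filter MeasureTheory

/-- Bessel function of the first kind of nonnegative integer order. -/
noncomputable def besselJ (n : ℕ) (z : ℂ) : ℂ :=
  (z / 2) ^ n * ∑' k : ℕ, (-(1/4 : ℂ)) ^ k * z ^ (2 * k) /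
    ((Nat.factorial k : ℂ) * (Nat.factorial (n + k) : ℂ))

/-- The digamma-at-integers function: ψ(1) = -γ, ψ(m) = -γ + ∑_{j=1}^{m-1} 1/j. -/
noncomputable def psiInt (m : ℕ) : ℝ :=
  -Real.eulerMascheroniConstant + ∑ j ∈ Finset.range (m - 1), 1 / (j + 1 : ℝ)

/-- Bessel function of the second kind of nonnegative integer order. -/
noncomputable def besselY (n : ℕ) (z : ℂ) : ℂ :=
  -(1 / (Real.pi : ℂ)) * (z / 2) ^ (-(n : ℤ)) *
      ∑ k ∈ Finset.range n, ((Nat.factorial (n - k - 1) : ℂ) / (Nat.factorial k : ℂ)) * (z ^ 2 / 4) ^ k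
    + (2 / (Real.pi : ℂ)) * Complex.log (z / 2) * besselJ n z
    - (1 / (Real.pi : ℂ)) * (z / 2) ^ n *
      ∑' k : ℕ, ((psiInt (k + 1) + psiInt (n + k + 1) : ℝ) : ℂ) * (-(1/4 : ℂ)) ^ k * z ^ (2 * k) /
        ((Nat.factorial k : ℂ) * (Nat.factorial (n + k) : ℂ))

/-- Hankel function of the first kind of integer order, with `H_{-n} = (-1)^n H_n`. -/
noncomputable def hankelH (n : ℤ) (z : ℂ) : ℂ :=
  if 0 ≤ n then besselJ n.toNat z + Complex.I * besselY n.toNat z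
  else (-1 : ℂ) ^ n.natAbs * (besselJ n.natAbs z + Complex.I * besselY n.natAbs z)

section FactorialBoundedSeries

variable {c : ℕ → ℂ} {C : ℝ}

lemma norm_mul_pow_le_of_norm_le_div_factorial (hc : ∀ k, ‖c k‖ ≤ C / (k.factorial : ℝ))
    {w : ℂ} {R : ℝ} (hw : ‖w‖ ≤ R) (k : ℕ) :
    ‖c k * w ^ k‖ ≤ C * (R ^ k / (k.factorial : ℝ)) := by
  rw [norm_mul, norm_pow]
  calc ‖c k‖ * ‖w‖ ^ k ≤ C / (k.factorial : ℝ) * R ^ k := by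
        gcongr
        · exact (norm_nonneg _).trans (hc k)
        · exact hc k
    _ = _ := by ring

lemma hasSum_const_mul_pow_div_factorial (C R : ℝ) :
    HasSum (fun k : ℕ => C * (R ^ k / (k.factorial : ℝ))) (C * Real.exp R) := by
  rw [Real.exp_eq_exp_ℝ]
  exact (NormedSpace.expSeries_div_hasSum_exp R).mul_left C

lemma summable_of_norm_le_div_factorial (hc : ∀ k, ‖c k‖ ≤ C / (k.factorial : ℝ)) (w : ℂ) :
    Summable (fun k => c k * w ^ k) :=
  .of_norm_bounded (hasSum_const_mul_pow_div_factorial C ‖w‖).summable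
    (norm_mul_pow_le_of_norm_le_div_factorial hc le_rfl)

lemma norm_tsum_le_of_norm_le_div_factorial (hc : ∀ k, ‖c k‖ ≤ C / (k.factorial : ℝ))
    {w : ℂ} {R : ℝ} (hw : ‖w‖ ≤ R) : ‖∑' k, c k * w ^ k‖ ≤ C * Real.exp R :=
  tsum_of_norm_bounded (hasSum_const_mul_pow_div_factorial C R)
    (norm_mul_pow_le_of_norm_le_div_factorial hc hw)

lemma differentiable_tsum_of_norm_le_div_factorial (hc : ∀ k, ‖c k‖ ≤ C / (k.factorial : ℝ)) :
    Differentiable ℂ (fun w => ∑' k, c k * w ^ k) := by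
  intro w
  have h : DifferentiableOn ℂ (fun w => ∑' k, c k * w ^ k) (Metric.ball 0 (‖w‖ + 1)) := by
    refine Complex.differentiableOn_tsum_of_summable_norm
      (hasSum_const_mul_pow_div_factorial C (‖w‖ + 1)).summable
      (fun k => by fun_prop) Metric.isOpen_ball fun k v hv => ?_
    exact norm_mul_pow_le_of_norm_le_div_factorial hc (mem_ball_zero_iff.mp hv).le k
  exact h.differentiableAt (Metric.isOpen_ball.mem_nhds (by simp))

end FactorialBoundedSeries

/-- Taylor coefficients of `besselJ` in the variable `-(z ^ 2 / 4)`. -/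
noncomputable def besselCoeff (n k : ℕ) : ℂ :=
  1 / ((k.factorial : ℂ) * ((n + k).factorial : ℂ))

/-- Taylor coefficients of the regular part of `besselY` in the variable `-(z ^ 2 / 4)`. -/
noncomputable def besselPsiCoeff (n k : ℕ) : ℂ :=
  ((psiInt (k + 1) + psiInt (n + k + 1) : ℝ) : ℂ) * besselCoeff n k

/-- The finite sum in the singular part of `besselY`. -/
noncomputable def besselSingular (n : ℕ) (u : ℂ) : ℂ :=
  ∑ k ∈ Finset.range n, ((Nat.factorial (n - k - 1) : ℂ) / (Nat.factorial k : ℂ)) * u ^ k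

/-- The power series factor of `besselJ`. -/
noncomputable def besselSeries (n : ℕ) (w : ℂ) : ℂ := ∑' k, besselCoeff n k * w ^ k

/-- The power series factor of the regular part of `besselY`. -/
noncomputable def besselPsiSeries (n : ℕ) (w : ℂ) : ℂ := ∑' k, besselPsiCoeff n k * w ^ k

/-- Hankel function of nonnegative integer order. -/
noncomputable def hankelNat (n : ℕ) (z : ℂ) : ℂ := besselJ n z + Complex.I * besselY n z

lemma neg_sq_div_four_pow (z : ℂ) (k : ℕ) :
    (-(z ^ 2 / 4)) ^ k = (-(1 / 4 : ℂ)) ^ k * z ^ (2 * k) := by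
  rw [pow_mul, ← mul_pow]; congr 1; ring

lemma besselJ_eq (n : ℕ) (z : ℂ) :
    besselJ n z = (z / 2) ^ n * besselSeries n (-(z ^ 2 / 4)) := by
  unfold besselJ besselSeries besselCoeff
  congr 1
  refine tsum_congr fun k => ?_
  rw [neg_sq_div_four_pow]; ring

lemma besselY_eq (n : ℕ) (z : ℂ) :
    besselY n z = -(1 / (Real.pi : ℂ)) * (z / 2) ^ (-(n : ℤ)) * besselSingular n (z ^ 2 / 4)
      + (2 / (Real.pi : ℂ)) * Complex.log (z / 2) * besselJ n z
      - (1 / (Real.pi : ℂ)) * (z / 2) ^ n * besselPsiSeries n (-(z ^ 2 / 4)) := by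
  unfold besselY besselPsiSeries besselPsiCoeff besselCoeff besselSingular
  congr 2
  refine tsum_congr fun k => ?_
  rw [neg_sq_div_four_pow]; ring

lemma psiInt_succ_succ (m : ℕ) : psiInt (m + 2) = psiInt (m + 1) + 1 / (m + 1 : ℝ) := by
  simp only [psiInt, Nat.add_sub_cancel, show m + 2 - 1 = m + 1 from rfl, Finset.sum_range_succ]
  ring

lemma abs_psiInt_succ_le (m : ℕ) : |psiInt (m + 1)| ≤ m + 1 := by
  induction m with
  | zero =>
    have h1 := Real.one_half_lt_eulerMascheroniConstant
    have h2 := Real.eulerMascheroniConstant_lt_two_thirds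
    simp only [psiInt, zero_add, Nat.sub_self, Finset.range_zero, Finset.sum_empty, add_zero,
      abs_neg, Nat.cast_zero]
    rw [abs_le]; constructor <;> linarith
  | succ m ih =>
    rw [psiInt_succ_succ]
    have h : |1 / (m + 1 : ℝ)| ≤ 1 := by
      rw [abs_of_nonneg (by positivity)]
      exact div_le_one_of_le₀ (by linarith [(Nat.cast_nonneg m : (0 : ℝ) ≤ m)]) (by positivity)
    push_cast
    linarith [abs_add_le (psiInt (m + 1)) (1 / (m + 1 : ℝ))]

lemma norm_besselCoeff (n k : ℕ) :
    ‖besselCoeff n k‖ = 1 / ((k.factorial : ℝ) * ((n + k).factorial : ℝ)) := by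
  simp [besselCoeff]

lemma norm_besselCoeff_le (n k : ℕ) : ‖besselCoeff n k‖ ≤ 1 / (k.factorial : ℝ) := by
  rw [norm_besselCoeff]
  gcongr
  have : (1 : ℝ) ≤ ((n + k).factorial : ℝ) := by exact_mod_cast Nat.factorial_pos _
  exact le_mul_of_one_le_right (by positivity) this

lemma succ_le_two_mul_factorial (m : ℕ) : m + 1 ≤ 2 * m.factorial := by
  have h1 := Nat.self_le_factorial m
  have h2 := Nat.factorial_pos m
  omega

lemma norm_besselPsiCoeff_le (n k : ℕ) : ‖besselPsiCoeff n k‖ ≤ 4 / (k.factorial : ℝ) := by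
  have h1 := abs_psiInt_succ_le k
  have h2 := abs_psiInt_succ_le (n + k)
  have h3 : ((n + k : ℕ) : ℝ) + 1 ≤ 2 * ((n + k).factorial : ℝ) := by
    exact_mod_cast succ_le_two_mul_factorial (n + k)
  have h4 : |psiInt (k + 1) + psiInt (n + k + 1)| ≤ 4 * ((n + k).factorial : ℝ) := by
    refine (abs_add_le _ _).trans ?_
    push_cast at *
    linarith [(Nat.cast_nonneg n : (0 : ℝ) ≤ n)]
  rw [besselPsiCoeff, norm_mul, norm_besselCoeff, Complex.norm_real, Real.norm_eq_abs]
  have h5 : (0 : ℝ) < ((n + k).factorial : ℝ) := by exact_mod_cast Nat.factorial_pos _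
  calc _ ≤ 4 * ((n + k).factorial : ℝ) * (1 / ((k.factorial : ℝ) * ((n + k).factorial : ℝ))) := by
        gcongr
    _ = _ := by field_simp

lemma tsum_sub_mul_tsum_sub_mul_tsum {a b d : ℕ → ℂ} {w s : ℂ}
    (ha : Summable fun k => a k * w ^ k) (hb : Summable fun k => b k * w ^ k)
    (hd : Summable fun k => d k * w ^ k) (h : ∀ k, a (k + 1) - b k - s * d (k + 1) = 0) :
    ∑' k, a k * w ^ k - w * ∑' k, b k * w ^ k - s * ∑' k, d k * w ^ k = a 0 - s * d 0 := by
  rw [ha.tsum_eq_zero_add, hd.tsum_eq_zero_add, mul_add, ← tsum_mul_left (a := s),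
    ← tsum_mul_left (a := w)]
  have ha' := (summable_nat_add_iff 1).mpr ha
  have hd' := ((summable_nat_add_iff 1).mpr hd).mul_left s
  have key : ∑' k, a (k + 1) * w ^ (k + 1) - ∑' k, w * (b k * w ^ k)
      - ∑' k, s * (d (k + 1) * w ^ (k + 1)) = 0 := by
    rw [← ha'.tsum_sub (hb.mul_left w), ← (ha'.sub (hb.mul_left w)).tsum_sub hd',
      ← tsum_zero (α := ℂ) (β := ℕ)]
    refine tsum_congr fun k => ?_
    linear_combination w ^ (k + 1) * h k
  linear_combination key

lemma besselSeries_recurrence (n : ℕ) (w : ℂ) :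
    besselSeries n w - w * besselSeries (n + 2) w - (n + 1) * besselSeries (n + 1) w = 0 := by
  have hs := fun n => summable_of_norm_le_div_factorial (norm_besselCoeff_le n) w
  unfold besselSeries
  rw [tsum_sub_mul_tsum_sub_mul_tsum (hs n) (hs (n + 2)) (hs (n + 1))]
  · have := Nat.cast_ne_zero (R := ℂ).mpr n.factorial_ne_zero
    have h' := Nat.cast_add_one_ne_zero (R := ℂ) n
    simp only [besselCoeff, add_zero, Nat.factorial_succ, Nat.factorial_zero]
    push_cast
    field_simp
    ring
  · intro k
    have h1 := Nat.cast_ne_zero (R := ℂ).mpr (n + k).factorial_ne_zero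
    have h2 := Nat.cast_ne_zero (R := ℂ).mpr k.factorial_ne_zero
    have h3 := Nat.cast_add_one_ne_zero (R := ℂ) k
    have h4 := Nat.cast_add_one_ne_zero (R := ℂ) (n + k)
    have h5 := Nat.cast_add_one_ne_zero (R := ℂ) (n + k + 1)
    simp only [besselCoeff, show n + (k + 1) = n + k + 1 by ring,
      show n + 2 + k = n + k + 1 + 1 by ring, show n + 1 + (k + 1) = n + k + 1 + 1 by ring,
      Nat.factorial_succ]
    push_cast at *
    field_simp
    ring

lemma besselPsiSeries_recurrence (n : ℕ) (w : ℂ) :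
    besselPsiSeries n w - w * besselPsiSeries (n + 2) w - (n + 1) * besselPsiSeries (n + 1) w
      = -1 / ((n + 1).factorial : ℂ) := by
  have hs := fun n => summable_of_norm_le_div_factorial (norm_besselPsiCoeff_le n) w
  unfold besselPsiSeries
  rw [tsum_sub_mul_tsum_sub_mul_tsum (hs n) (hs (n + 2)) (hs (n + 1))]
  · have := Nat.cast_ne_zero (R := ℂ).mpr n.factorial_ne_zero
    have h' := Nat.cast_add_one_ne_zero (R := ℂ) n
    simp only [besselPsiCoeff, besselCoeff, add_zero, Nat.factorial_succ, Nat.factorial_zero,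
      show n + 1 + 1 = n + 2 by ring, psiInt_succ_succ]
    push_cast
    field_simp
    ring
  · intro k
    have h1 := Nat.cast_ne_zero (R := ℂ).mpr (n + k).factorial_ne_zero
    have h2 := Nat.cast_ne_zero (R := ℂ).mpr k.factorial_ne_zero
    have h3 := Nat.cast_add_one_ne_zero (R := ℂ) k
    have h4 := Nat.cast_add_one_ne_zero (R := ℂ) (n + k)
    have h5 := Nat.cast_add_one_ne_zero (R := ℂ) (n + k + 1)
    have h6 : (n : ℂ) + k + 2 ≠ 0 := by exact_mod_cast (n + k + 1).succ_ne_zero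
    have e1 := psiInt_succ_succ k
    have e2 := psiInt_succ_succ (n + k + 1)
    simp only [besselPsiCoeff, besselCoeff, show n + (k + 1) = n + k + 1 by ring,
      show n + 2 + k = n + k + 2 by ring, show n + 1 + (k + 1) = n + k + 2 by ring,
      show k + 1 + 1 = k + 2 by ring, show n + k + 1 + 1 = n + k + 2 by ring,
      show n + k + 2 + 1 = n + k + 1 + 2 by ring, e1, e2,
      Nat.factorial_succ (n + k), Nat.factorial_succ (n + k + 1), Nat.factorial_succ k]
    push_cast at *
    field_simp
    ring

lemma besselSingular_recurrence (n : ℕ) (u : ℂ) :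
    besselSingular (n + 2) u + u * besselSingular n u - (n + 1) * besselSingular (n + 1) u
      = u ^ (n + 1) / ((n + 1).factorial : ℂ) := by
  unfold besselSingular
  rw [Finset.sum_range_succ, Finset.sum_range_succ', Finset.sum_range_succ' _ n, Finset.mul_sum,
    mul_add, Finset.mul_sum]
  have key : ∑ k ∈ Finset.range n, ((Nat.factorial (n + 2 - (k + 1) - 1) : ℂ) /
        (Nat.factorial (k + 1) : ℂ)) * u ^ (k + 1)
      + ∑ k ∈ Finset.range n, u * ((Nat.factorial (n - k - 1) : ℂ) / (Nat.factorial k : ℂ) * u ^ k)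
      - ∑ k ∈ Finset.range n, ((n : ℂ) + 1) * ((Nat.factorial (n + 1 - (k + 1) - 1) : ℂ) /
        (Nat.factorial (k + 1) : ℂ) * u ^ (k + 1)) = 0 := by
    rw [← Finset.sum_add_distrib, ← Finset.sum_sub_distrib]
    refine Finset.sum_eq_zero fun k hk => ?_
    obtain ⟨d, rfl⟩ := Nat.exists_eq_add_of_lt (Finset.mem_range.mp hk)
    have h2 := Nat.cast_ne_zero (R := ℂ).mpr k.factorial_ne_zero
    have h3 := Nat.cast_add_one_ne_zero (R := ℂ) k
    rw [show k + d + 1 + 2 - (k + 1) - 1 = d + 1 by omega, show k + d + 1 - k - 1 = d by omega,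
      show k + d + 1 + 1 - (k + 1) - 1 = d by omega, Nat.factorial_succ, Nat.factorial_succ]
    push_cast
    field_simp
    ring
  have e : n + 2 - (n + 1) - 1 = 0 := by omega
  simp only [e, Nat.sub_zero, Nat.factorial_zero, pow_zero, Nat.cast_one,
    show n + 2 - 1 = n + 1 from rfl, Nat.add_sub_cancel, Nat.factorial_succ] at key ⊢
  push_cast at key ⊢
  linear_combination key

lemma besselJ_recurrence (n : ℕ) {z : ℂ} (hz : z ≠ 0) :
    besselJ (n + 2) z + besselJ n z = 2 * (n + 1) / z * besselJ (n + 1) z := by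
  simp only [besselJ_eq]
  have h := besselSeries_recurrence n (-(z ^ 2 / 4))
  field_simp
  linear_combination (z / 2) ^ n * z * h

lemma besselY_recurrence (n : ℕ) {z : ℂ} (hz : z ≠ 0) :
    besselY (n + 2) z + besselY n z = 2 * (n + 1) / z * besselY (n + 1) z := by
  simp only [besselY_eq]
  have h1 := besselSingular_recurrence n (z ^ 2 / 4)
  have h2 := besselPsiSeries_recurrence n (-(z ^ 2 / 4))
  have h3 := besselJ_recurrence n hz
  obtain ⟨v, rfl⟩ : ∃ v, z = 2 * v := ⟨z / 2, by ring⟩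
  have hv : v ≠ 0 := by rintro rfl; simp at hz
  have e1 : (2 * v) ^ 2 / 4 = v ^ 2 := by ring
  have e2 : 2 * v / 2 = v := by ring
  have e3 : 2 * ((n : ℂ) + 1) / (2 * v) = (n + 1) * v⁻¹ := by field_simp
  simp only [e1, e2, e3, zpow_neg, zpow_natCast] at *
  have e4 : (v ^ (n + 2))⁻¹ * (v ^ 2) ^ (n + 1) = v ^ n := by field_simp; ring
  have e5 : (v ^ (n + 2))⁻¹ * v ^ 2 = (v ^ n)⁻¹ := by field_simp; ring
  have e6 : (v ^ (n + 2))⁻¹ = (v ^ (n + 1))⁻¹ * v⁻¹ := by field_simp; ring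
  have e7 : v ^ (n + 1) * v⁻¹ = v ^ n := by field_simp; ring
  linear_combination -(1 / (Real.pi : ℂ)) * (v ^ (n + 2))⁻¹ * h1
    - (1 / (Real.pi : ℂ)) * v ^ n * h2 + 2 / (Real.pi : ℂ) * Complex.log v * h3
    - (1 / (Real.pi : ℂ)) / ((n + 1).factorial : ℂ) * e4
    + (1 / (Real.pi : ℂ)) * besselSingular n (v ^ 2) * e5
    - (1 / (Real.pi : ℂ)) * (n + 1) * besselSingular (n + 1) (v ^ 2) * e6
    + (1 / (Real.pi : ℂ)) * (n + 1) * besselPsiSeries (n + 1) (-v ^ 2) * e7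

lemma hankelNat_recurrence (n : ℕ) {z : ℂ} (hz : z ≠ 0) :
    hankelNat (n + 2) z + hankelNat n z = 2 * (n + 1) / z * hankelNat (n + 1) z := by
  unfold hankelNat
  linear_combination besselJ_recurrence n hz + Complex.I * besselY_recurrence n hz

lemma casoratian_eq_casoratian_zero (n : ℕ) {z : ℂ} (hz : z ≠ 0) :
    besselJ (n + 1) z * hankelNat n z - besselJ n z * hankelNat (n + 1) z
      = besselJ 1 z * hankelNat 0 z - besselJ 0 z * hankelNat 1 z := by
  induction n with
  | zero => rfl
  | succ n ih =>
    rw [← ih]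
    linear_combination hankelNat (n + 1) z * besselJ_recurrence n hz
      - besselJ (n + 1) z * hankelNat_recurrence n hz

lemma add_one_mul_factorial_le (n k : ℕ) : (n + 1) * n.factorial ≤ (n + (k + 1)).factorial := by
  rw [← Nat.factorial_succ]
  exact Nat.factorial_le (by omega)

lemma norm_factorial_mul_besselSeries_sub_one_le (n : ℕ) (w : ℂ) :
    ‖n.factorial * besselSeries n w - 1‖ ≤ 1 / (n + 1 : ℝ) * Real.exp ‖w‖ := by
  have h0 : (n.factorial : ℂ) ≠ 0 := Nat.cast_ne_zero.mpr n.factorial_ne_zero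
  have hs := summable_of_norm_le_div_factorial (norm_besselCoeff_le n) w
  let d : ℕ → ℂ := fun k => if k = 0 then 0 else n.factorial * besselCoeff n k
  have hd : ∀ k, ‖d k‖ ≤ 1 / (n + 1 : ℝ) / (k.factorial : ℝ) := by
    rintro (_ | k)
    · simp only [d, if_true, norm_zero]; positivity
    · have h := add_one_mul_factorial_le n k
      have h' : ((n : ℝ) + 1) * n.factorial ≤ ((n + (k + 1)).factorial : ℝ) := by exact_mod_cast h
      have h1 : (0 : ℝ) < ((n + (k + 1)).factorial : ℝ) := by exact_mod_cast Nat.factorial_pos _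
      have h2 : (0 : ℝ) < ((k + 1).factorial : ℝ) := by exact_mod_cast Nat.factorial_pos _
      simp only [d, Nat.succ_ne_zero, if_false, norm_mul, norm_besselCoeff, Complex.norm_natCast]
      rw [div_div, mul_one_div, div_le_div_iff₀ (by positivity) (by positivity)]
      nlinarith [mul_le_mul_of_nonneg_left h' h2.le]
  have e : n.factorial * besselSeries n w - 1 = ∑' k, d k * w ^ k := by
    rw [besselSeries, hs.tsum_eq_zero_add,
      (summable_of_norm_le_div_factorial hd w).tsum_eq_zero_add, mul_add, ← tsum_mul_left]
    simp [d, besselCoeff, h0, mul_assoc]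
  rw [e]
  exact norm_tsum_le_of_norm_le_div_factorial hd le_rfl

lemma tendsto_factorial_mul_besselSeries (w : ℂ) :
    Tendsto (fun n : ℕ => n.factorial * besselSeries n w) atTop (nhds 1) := by
  rw [tendsto_iff_norm_sub_tendsto_zero]
  refine squeeze_zero (fun _ => norm_nonneg _)
    (fun n => norm_factorial_mul_besselSeries_sub_one_le n w) ?_
  simpa using tendsto_one_div_add_atTop_nhds_zero_nat.mul_const (Real.exp ‖w‖)

lemma norm_besselSingular_div_sub_one_le (m : ℕ) {u : ℂ} {R : ℝ} (hu : ‖u‖ ≤ R) :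
    ‖besselSingular (m + 1) u / m.factorial - 1‖ ≤ 1 / (m : ℝ) * Real.exp R := by
  have h0 : (m.factorial : ℂ) ≠ 0 := Nat.cast_ne_zero.mpr m.factorial_ne_zero
  have hm : (0 : ℝ) < m.factorial := by exact_mod_cast m.factorial_pos
  let d : ℕ → ℂ := fun k =>
    if k = 0 ∨ m < k then 0 else ((m - k).factorial : ℂ) / (k.factorial : ℂ) / m.factorial
  have hd : ∀ k, ‖d k‖ ≤ 1 / (m : ℝ) / (k.factorial : ℝ) := by
    intro k
    by_cases hk : k = 0 ∨ m < k
    · simp only [d, hk, if_true, norm_zero]; positivity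
    · simp only [d, hk, if_false, norm_div, Complex.norm_natCast]
      push Not at hk
      obtain ⟨p, rfl⟩ := Nat.exists_eq_add_of_le' (show 1 ≤ m by omega)
      have h : (p + 1 - k).factorial ≤ p.factorial := Nat.factorial_le (by omega)
      have h' : ((p + 1 - k).factorial : ℝ) ≤ (p.factorial : ℝ) := by exact_mod_cast h
      have h1 : (0 : ℝ) < p.factorial := by exact_mod_cast p.factorial_pos
      rw [Nat.factorial_succ, div_right_comm]
      refine div_le_div_of_nonneg_right ?_ (by positivity)
      rw [div_le_div_iff₀ (by positivity) (by positivity)]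
      push_cast
      nlinarith
  have e : besselSingular (m + 1) u / m.factorial - 1 = ∑' k, d k * u ^ k := by
    rw [tsum_eq_sum (s := Finset.range (m + 1)) (fun k hk => by
      have : m < k := by simpa using hk
      simp [d, this]), besselSingular, Finset.sum_range_succ', Finset.sum_range_succ',
      add_div, Finset.sum_div]
    have hc : ∑ k ∈ Finset.range m, ((m + 1 - (k + 1) - 1).factorial : ℂ) / ((k + 1).factorial : ℂ)
        * u ^ (k + 1) / m.factorial = ∑ k ∈ Finset.range m, d (k + 1) * u ^ (k + 1) := by
      refine Finset.sum_congr rfl fun k hk => ?_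
      have hk' : ¬ (k + 1 = 0 ∨ m < k + 1) := by have := Finset.mem_range.mp hk; omega
      simp only [d, hk', if_false, show m + 1 - (k + 1) - 1 = m - (k + 1) by omega]
      ring
    rw [hc]
    simp [d, h0]
  rw [e]
  exact norm_tsum_le_of_norm_le_div_factorial hd hu

/-- `hankelNat (m + 1)` divided by the modulus of its singular leading coefficient at `0`. -/
noncomputable def scaledHankel (m : ℕ) (z : ℂ) : ℂ :=
  hankelNat (m + 1) z * (z / 2) ^ (m + 1) / m.factorial

lemma scaledHankel_eq (m : ℕ) {z : ℂ} (hz : z ≠ 0) :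
    scaledHankel m z = -(Complex.I / Real.pi) * (besselSingular (m + 1) (z ^ 2 / 4) / m.factorial)
      + (z ^ 2 / 4) ^ (m + 1) / m.factorial *
        ((1 + 2 * Complex.I / Real.pi * Complex.log (z / 2)) * besselSeries (m + 1) (-(z ^ 2 / 4))
          - Complex.I / Real.pi * besselPsiSeries (m + 1) (-(z ^ 2 / 4))) := by
  have h0 : (m.factorial : ℂ) ≠ 0 := Nat.cast_ne_zero.mpr m.factorial_ne_zero
  have hpi : (Real.pi : ℂ) ≠ 0 := by exact_mod_cast Real.pi_ne_zero
  have h2 : z / 2 ≠ 0 := div_ne_zero hz two_ne_zero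
  have e1 : (z / 2) ^ (-((m + 1 : ℕ) : ℤ)) * (z / 2) ^ (m + 1) = 1 := by
    rw [zpow_neg, zpow_natCast]; exact inv_mul_cancel₀ (pow_ne_zero _ h2)
  have e2 : (z / 2) ^ (m + 1) * (z / 2) ^ (m + 1) = (z ^ 2 / 4) ^ (m + 1) := by
    rw [← mul_pow]; congr 1; ring
  unfold scaledHankel hankelNat
  rw [besselY_eq, besselJ_eq, ← e2]
  generalize (z / 2) ^ (-((m + 1 : ℕ) : ℤ)) = X at *
  generalize besselSeries _ _ = A, besselPsiSeries _ _ = B, besselSingular _ _ = S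
  linear_combination (-(Complex.I / Real.pi) * S / m.factorial) * e1

lemma norm_I_div_pi_le_one : ‖Complex.I / (Real.pi : ℂ)‖ ≤ 1 := by
  rw [norm_div, Complex.norm_I, Complex.norm_real, Real.norm_of_nonneg Real.pi_pos.le]
  exact div_le_one_of_le₀ (by linarith [Real.pi_gt_three]) Real.pi_pos.le

lemma norm_scaledHankel_sub_le (m : ℕ) {z : ℂ} (hz : z ≠ 0) {R L : ℝ}
    (hR : ‖z ^ 2 / 4‖ ≤ R) (hL : ‖Complex.log (z / 2)‖ ≤ L) :
    ‖scaledHankel m z - -(Complex.I / Real.pi)‖ ≤ 1 / (m : ℝ) * Real.exp R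
      + R * (R ^ m / (m.factorial : ℝ)) * ((1 + 2 * L) * Real.exp R + 4 * Real.exp R) := by
  have hI := norm_I_div_pi_le_one
  have hR0 := (norm_nonneg _).trans hR
  have hL0 := (norm_nonneg _).trans hL
  have hS := norm_besselSingular_div_sub_one_le m hR
  have hR' : ‖-(z ^ 2 / 4)‖ ≤ R := by rwa [norm_neg]
  have hA : ‖besselSeries (m + 1) (-(z ^ 2 / 4))‖ ≤ 1 * Real.exp R :=
    norm_tsum_le_of_norm_le_div_factorial (norm_besselCoeff_le _) hR'
  have hB : ‖besselPsiSeries (m + 1) (-(z ^ 2 / 4))‖ ≤ 4 * Real.exp R :=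
    norm_tsum_le_of_norm_le_div_factorial (norm_besselPsiCoeff_le _) hR'
  rw [scaledHankel_eq m hz]
  generalize besselSeries _ _ = A at *
  generalize besselPsiSeries _ _ = B at *
  generalize besselSingular _ _ = S at *
  generalize Complex.log _ = l at *
  generalize z ^ 2 / 4 = u at *
  rw [show -(Complex.I / Real.pi) * (S / m.factorial) + u ^ (m + 1) / m.factorial *
      ((1 + 2 * Complex.I / Real.pi * l) * A - Complex.I / Real.pi * B) - -(Complex.I / Real.pi)
      = -(Complex.I / Real.pi * (S / m.factorial - 1)) + u * (u ^ m / m.factorial) *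
      ((1 + 2 * (Complex.I / Real.pi * l)) * A - Complex.I / Real.pi * B) by ring]
  generalize Complex.I / (Real.pi : ℂ) = c at *
  have h1 : ‖c * (S / m.factorial - 1)‖ ≤ 1 * (1 / (m : ℝ) * Real.exp R) := by
    rw [norm_mul]; gcongr
  have h2 : ‖1 + 2 * (c * l)‖ ≤ 1 + 2 * L := by
    refine (norm_add_le _ _).trans ?_
    rw [norm_one, norm_mul, norm_mul, Complex.norm_two]
    have : ‖c‖ * ‖l‖ ≤ 1 * L := by gcongr
    linarith
  have h3 : ‖(1 + 2 * (c * l)) * A - c * B‖ ≤ (1 + 2 * L) * Real.exp R + 4 * Real.exp R := by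
    refine (norm_sub_le _ _).trans ?_
    rw [norm_mul, norm_mul]
    have e1 : ‖1 + 2 * (c * l)‖ * ‖A‖ ≤ (1 + 2 * L) * (1 * Real.exp R) := by gcongr
    have e2 : ‖c‖ * ‖B‖ ≤ 1 * (4 * Real.exp R) := by gcongr
    linarith
  have h4 : ‖u * (u ^ m / m.factorial)‖ ≤ R * (R ^ m / (m.factorial : ℝ)) := by
    rw [norm_mul, norm_div, norm_pow, Complex.norm_natCast]; gcongr
  refine (norm_add_le _ _).trans ?_
  rw [norm_neg, norm_mul (u * _)]
  have h5 := mul_le_mul h4 h3 (norm_nonneg _) (by positivity)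
  linarith

lemma tendsto_scaledHankel_error (R L : ℝ) :
    Tendsto (fun m : ℕ => 1 / (m : ℝ) * Real.exp R
      + R * (R ^ m / (m.factorial : ℝ)) * ((1 + 2 * L) * Real.exp R + 4 * Real.exp R))
      atTop (nhds 0) := by
  have h1 := tendsto_one_div_atTop_nhds_zero_nat (𝕜 := ℝ)
  have h2 := FloorSemiring.tendsto_pow_div_factorial_atTop R
  simpa using (h1.mul_const (Real.exp R)).add
    ((h2.const_mul R).mul_const ((1 + 2 * L) * Real.exp R + 4 * Real.exp R))

lemma tendstoLocallyUniformlyOn_scaledHankel :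
    TendstoLocallyUniformlyOn scaledHankel (fun _ => -(Complex.I / Real.pi)) atTop slitPlane := by
  rw [tendstoLocallyUniformlyOn_iff_forall_isCompact isOpen_slitPlane]
  intro K hK hKc
  have hlog : ContinuousOn (fun z : ℂ => Complex.log (z / 2)) K := by
    refine ContinuousOn.clog (by fun_prop) fun z hz => ?_
    have := hK hz
    simpa [mem_slitPlane_iff] using this
  obtain ⟨L, hL⟩ := hKc.exists_bound_of_continuousOn hlog
  obtain ⟨R, hR⟩ := hKc.exists_bound_of_continuousOn
    (f := fun z : ℂ => z ^ 2 / 4) (by fun_prop)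
  rw [Metric.tendstoUniformlyOn_iff]
  intro ε hε
  filter_upwards [(tendsto_scaledHankel_error R L).eventually_lt_const hε] with m hm z hz
  rw [dist_comm, dist_eq_norm]
  exact (norm_scaledHankel_sub_le m (slitPlane_ne_zero (hK hz)) (hR z hz) (hL z hz)).trans_lt hm

lemma differentiableOn_hankelNat (n : ℕ) : DifferentiableOn ℂ (hankelNat n) slitPlane := by
  have hA : Differentiable ℂ (besselSeries n) :=
    differentiable_tsum_of_norm_le_div_factorial (norm_besselCoeff_le n)
  have hB : Differentiable ℂ (besselPsiSeries n) :=
    differentiable_tsum_of_norm_le_div_factorial (norm_besselPsiCoeff_le n)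
  have hS : Differentiable ℂ (besselSingular n) := by unfold besselSingular; fun_prop
  have hJ : Differentiable ℂ (besselJ n) := by
    rw [funext (besselJ_eq n)]
    exact Differentiable.mul (by fun_prop) (hA.comp (by fun_prop))
  intro z hz
  have hz0 := slitPlane_ne_zero hz
  have hz2 : z / 2 ∈ slitPlane := by simpa [mem_slitPlane_iff] using hz
  refine DifferentiableAt.differentiableWithinAt ?_
  have hY : DifferentiableAt ℂ (besselY n) z := by
    rw [funext (besselY_eq n)]
    have h1 : DifferentiableAt ℂ (fun z : ℂ => (z / 2) ^ (-(n : ℤ))) z :=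
      DifferentiableAt.zpow (by fun_prop) (Or.inl (div_ne_zero hz0 two_ne_zero))
    have h2 : DifferentiableAt ℂ (fun z : ℂ => Complex.log (z / 2)) z :=
      DifferentiableAt.clog (by fun_prop) hz2
    have h3 : Differentiable ℂ (fun z : ℂ => besselSingular n (z ^ 2 / 4)) :=
      hS.comp (by fun_prop)
    have h4 : Differentiable ℂ (fun z : ℂ => besselPsiSeries n (-(z ^ 2 / 4))) :=
      hB.comp (by fun_prop)
    fun_prop
  unfold hankelNat
  fun_prop

lemma differentiableOn_scaledHankel (m : ℕ) : DifferentiableOn ℂ (scaledHankel m) slitPlane := by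
  have := differentiableOn_hankelNat (m + 1)
  unfold scaledHankel
  fun_prop

lemma tendsto_scaledHankel {z : ℂ} (hz : z ∈ slitPlane) :
    Tendsto (fun m => scaledHankel m z) atTop (nhds (-(Complex.I / Real.pi))) :=
  tendstoLocallyUniformlyOn_scaledHankel.tendsto_at hz

lemma tendsto_deriv_scaledHankel {z : ℂ} (hz : z ∈ slitPlane) :
    Tendsto (fun m => deriv (scaledHankel m) z) atTop (nhds 0) := by
  have h := (tendstoLocallyUniformlyOn_scaledHankel.deriv
    (Eventually.of_forall differentiableOn_scaledHankel) isOpen_slitPlane).tendsto_at hz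
  simpa using h

lemma I_div_pi_ne_zero : Complex.I / (Real.pi : ℂ) ≠ 0 :=
  div_ne_zero Complex.I_ne_zero (by exact_mod_cast Real.pi_ne_zero)

lemma casoratian_eq {z : ℂ} (hz : z ∈ slitPlane) (n : ℕ) :
    besselJ (n + 1) z * hankelNat n z - besselJ n z * hankelNat (n + 1) z
      = 2 * Complex.I / (Real.pi * z) := by
  have hz0 := slitPlane_ne_zero hz
  have hpi : (Real.pi : ℂ) ≠ 0 := by exact_mod_cast Real.pi_ne_zero
  have hf := tendsto_scaledHankel hz
  have hf1 := (tendsto_add_atTop_iff_nat 1).mpr hf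
  have ha := tendsto_factorial_mul_besselSeries (-(z ^ 2 / 4))
  have ha1 := (tendsto_add_atTop_iff_nat 1).mpr ha
  have ha2 := (tendsto_add_atTop_iff_nat 2).mpr ha
  have hd1 : Tendsto (fun m : ℕ => 1 / ((m : ℂ) + 1)) atTop (nhds 0) :=
    tendsto_one_div_add_atTop_nhds_zero_nat
  have hd2 : Tendsto (fun m : ℕ => 1 / (((m + 1 : ℕ) : ℂ) + 1)) atTop (nhds 0) :=
    (tendsto_add_atTop_iff_nat 1).mpr hd1
  have hlim := (((((ha2.mul hf).mul hd1).mul hd2).const_mul (z / 2))).sub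
    ((ha1.mul hf1).const_mul (2 / z))
  have e : ∀ m : ℕ, besselJ (n + 1) z * hankelNat n z - besselJ n z * hankelNat (n + 1) z
      = z / 2 * (((m + 2).factorial * besselSeries (m + 2) (-(z ^ 2 / 4)) * scaledHankel m z)
        * (1 / ((m : ℂ) + 1)) * (1 / (((m + 1 : ℕ) : ℂ) + 1)))
        - 2 / z * ((m + 1).factorial * besselSeries (m + 1) (-(z ^ 2 / 4))
          * scaledHankel (m + 1) z) := by
    intro m
    rw [casoratian_eq_casoratian_zero n hz0, ← casoratian_eq_casoratian_zero (m + 1) hz0]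
    simp only [besselJ_eq, scaledHankel, Nat.factorial_succ]
    have h0 : (m.factorial : ℂ) ≠ 0 := Nat.cast_ne_zero.mpr m.factorial_ne_zero
    have h1 := Nat.cast_add_one_ne_zero (R := ℂ) m
    have h2 : (m : ℂ) + 1 + 1 ≠ 0 := by exact_mod_cast (m + 1).succ_ne_zero
    push_cast
    field_simp
    ring
  have := tendsto_nhds_unique (tendsto_const_nhds.congr e) hlim
  rw [this]
  field_simp
  ring

lemma exists_besselJ_eq_ofReal (n : ℕ) (x : ℝ) : ∃ y : ℝ, besselJ n x = y :=
  ⟨(x / 2) ^ n * ∑' k : ℕ, (-(1/4 : ℝ)) ^ k * x ^ (2 * k) /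
    ((Nat.factorial k : ℝ) * (Nat.factorial (n + k) : ℝ)), by unfold besselJ; push_cast; rfl⟩

lemma exists_besselY_eq_ofReal (n : ℕ) {x : ℝ} (hx : 0 < x) : ∃ y : ℝ, besselY n x = y := by
  obtain ⟨j, hj⟩ := exists_besselJ_eq_ofReal n x
  have hl : Complex.log (x / 2) = (Real.log (x / 2) : ℝ) := by
    rw [Complex.ofReal_log (by positivity)]; push_cast; rfl
  unfold besselY
  rw [hj, hl]
  exact ⟨-(1 / Real.pi) * (x / 2) ^ (-(n : ℤ)) *
      ∑ k ∈ Finset.range n, ((Nat.factorial (n - k - 1) : ℝ) / (Nat.factorial k : ℝ)) *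
        (x ^ 2 / 4) ^ k
    + (2 / Real.pi) * Real.log (x / 2) * j
    - (1 / Real.pi) * (x / 2) ^ n *
      ∑' k : ℕ, (psiInt (k + 1) + psiInt (n + k + 1)) * (-(1/4 : ℝ)) ^ k * x ^ (2 * k) /
        ((Nat.factorial k : ℝ) * (Nat.factorial (n + k) : ℝ)), by push_cast; rfl⟩

lemma hankelNat_ne_zero (n : ℕ) {x : ℝ} (hx : 0 < x) : hankelNat n x ≠ 0 := by
  intro h
  obtain ⟨j, hj⟩ := exists_besselJ_eq_ofReal n x
  obtain ⟨y, hy⟩ := exists_besselY_eq_ofReal n hx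
  have hj0 : j = 0 := by
    have := congrArg Complex.re h
    simpa [hankelNat, hj, hy] using this
  have hc := casoratian_eq (Complex.ofReal_mem_slitPlane.mpr hx) n
  rw [h, hj, hj0, Complex.ofReal_zero, mul_zero, zero_mul, sub_zero] at hc
  have hx0 : (x : ℂ) ≠ 0 := by exact_mod_cast hx.ne'
  have hpi : (Real.pi : ℂ) ≠ 0 := by exact_mod_cast Real.pi_ne_zero
  exact div_ne_zero (mul_ne_zero two_ne_zero Complex.I_ne_zero) (mul_ne_zero hpi hx0) hc.symm

lemma logDeriv_scaledHankel (m : ℕ) {z : ℂ} (hz : z ∈ slitPlane) (h : hankelNat (m + 1) z ≠ 0) :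
    z * deriv (hankelNat (m + 1)) z / ((m + 1 : ℕ) * hankelNat (m + 1) z)
      = -1 + z * (1 / ((m : ℂ) + 1)) * (deriv (scaledHankel m) z / scaledHankel m z) := by
  have hz0 := slitPlane_ne_zero hz
  have h0 : (m.factorial : ℂ) ≠ 0 := Nat.cast_ne_zero.mpr m.factorial_ne_zero
  have h1 := Nat.cast_add_one_ne_zero (R := ℂ) m
  have hd := ((differentiableOn_hankelNat (m + 1)).differentiableAt
    (isOpen_slitPlane.mem_nhds hz)).hasDerivAt
  have hs := (hd.mul (((hasDerivAt_id z).div_const 2).pow (m + 1))).div_const (m.factorial : ℂ)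
  have hs' : deriv (scaledHankel m) z = _ := hs.deriv
  rw [hs', scaledHankel]
  have hP : (z / 2) ^ m ≠ 0 := pow_ne_zero _ (div_ne_zero hz0 two_ne_zero)
  simp only [id, Nat.add_sub_cancel, Pi.pow_apply, pow_succ]
  generalize (z / 2) ^ m = P at *
  push_cast
  field_simp
  ring

lemma tendsto_hankelNat {x : ℝ} (hx : 0 < x) :
    Tendsto (fun n : ℕ => (x : ℂ) * deriv (hankelNat n) x / (n * hankelNat n x))
      atTop (nhds (-1)) := by
  have hz := Complex.ofReal_mem_slitPlane.mpr hx
  rw [← tendsto_add_atTop_iff_nat 1]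
  simp_rw [logDeriv_scaledHankel _ hz (hankelNat_ne_zero _ hx)]
  have h1 : Tendsto (fun m : ℕ => 1 / ((m : ℂ) + 1)) atTop (nhds 0) :=
    tendsto_one_div_add_atTop_nhds_zero_nat
  simpa using ((h1.const_mul (x : ℂ)).mul ((tendsto_deriv_scaledHankel hz).div
    (tendsto_scaledHankel hz) (neg_ne_zero.mpr I_div_pi_ne_zero))).const_add (-1)

lemma exists_hankelH_eq (n : ℤ) :
    ∃ s : ℂ, s ≠ 0 ∧ hankelH n = fun z => s * hankelNat n.natAbs z := by
  by_cases hn : 0 ≤ n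
  · refine ⟨1, one_ne_zero, funext fun z => ?_⟩
    rw [hankelH, if_pos hn, one_mul, hankelNat, show n.toNat = n.natAbs by omega]
  · refine ⟨(-1) ^ n.natAbs, by simp, funext fun z => ?_⟩
    rw [hankelH, if_neg hn, hankelNat]

/-- for fixed real `k > 0`, `k H_n'(k)/H_n(k) ~ -|n|` as `|n| → ∞` over the
integers (and `H_n(k) ≠ 0` for all `n`). -/
theorem stmt8 (k : ℝ) (hk : 0 < k) :
    (∀ n : ℤ, hankelH n k ≠ 0) ∧
    Tendsto (fun n : ℤ => ((k : ℂ) * deriv (hankelH n) k) / ((n.natAbs : ℂ) * hankelH n k))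
      cofinite (nhds (-1)) := by
  refine ⟨fun n => ?_, ?_⟩
  · obtain ⟨s, hs, h⟩ := exists_hankelH_eq n
    rw [h]
    exact mul_ne_zero hs (hankelNat_ne_zero _ hk)
  · have habs : Tendsto Int.natAbs cofinite atTop := by
      rw [← Nat.cofinite_eq_atTop]
      refine Tendsto.cofinite_of_finite_preimage_singleton fun m => ?_
      refine (Set.finite_Icc (-(m : ℤ)) m).subset fun n hn => ?_
      have : n.natAbs = m := hn
      simp only [Set.mem_Icc]
      omega
    refine ((tendsto_hankelNat hk).comp habs).congr fun n => ?_
    obtain ⟨s, hs, h⟩ := exists_hankelH_eq n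
    have hd : deriv (hankelH n) k = s * deriv (hankelNat n.natAbs) k := by
      rw [h]; exact deriv_const_mul_field s
    rw [hd, h, Function.comp_apply, mul_left_comm, mul_left_comm _ s, mul_div_mul_left _ _ hs]
end

section
/- For every real x with −1/2 < x < 1/2, lim_{k→∞} ∫_{−1/2}^{1/2} (k/2) · H_0(k|x−y|) dy = 1 (the integrand has an integrable logarithmic singularity at y = x, so the integral is well defined for each k > 0). -/
open Complex Filter MeasureTheory

/-- The sum of the real power series with coefficients `a`. -/
noncomputable def powSum (a : ℕ → ℝ) (x : ℝ) : ℝ := ∑' k, a k * x ^ k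

/-- The coefficients of the formal derivative of a power series. -/
def derivCoeff (a : ℕ → ℝ) (k : ℕ) : ℝ := (k + 1) * a (k + 1)

theorem abs_derivCoeff_le {a : ℕ → ℝ} (ha : ∀ k, |a k| ≤ 1 / (k.factorial : ℝ)) (k : ℕ) :
    |derivCoeff a k| ≤ 1 / (k.factorial : ℝ) := by
  have h := ha (k + 1)
  have hk : (0 : ℝ) < k + 1 := by positivity
  rw [derivCoeff, abs_mul, abs_of_pos hk]
  calc ((k : ℝ) + 1) * |a (k + 1)| ≤ (k + 1) * (1 / ((k + 1).factorial : ℝ)) := by gcongr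
    _ = 1 / (k.factorial : ℝ) := by
      rw [Nat.factorial_succ]; push_cast; field_simp

theorem summable_powSum {a : ℕ → ℝ} (ha : ∀ k, |a k| ≤ 1 / (k.factorial : ℝ)) (x : ℝ) :
    Summable fun k => a k * x ^ k := by
  refine Summable.of_norm_bounded (Real.summable_pow_div_factorial |x|) fun k => ?_
  rw [Real.norm_eq_abs, abs_mul, abs_pow, div_eq_mul_one_div, mul_comm]
  gcongr
  exact ha k

theorem hasDerivAt_powSum {a : ℕ → ℝ} (ha : ∀ k, |a k| ≤ 1 / (k.factorial : ℝ)) (x : ℝ) :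
    HasDerivAt (powSum a) (powSum (derivCoeff a) x) x := by
  set R : ℝ := |x| + 1
  have hR : 0 < R := by positivity
  have hu : Summable fun n : ℕ => |a n| * (n * R ^ (n - 1)) := by
    rw [← summable_nat_add_iff 1]
    refine Summable.of_nonneg_of_le (fun n => by positivity) (fun n => ?_)
      (Real.summable_pow_div_factorial R)
    have h := abs_derivCoeff_le ha n
    rw [derivCoeff, abs_mul, abs_of_pos (by positivity : (0 : ℝ) < n + 1)] at h
    push_cast
    rw [div_eq_mul_one_div]
    calc |a (n + 1)| * ((n + 1) * R ^ n) = R ^ n * ((n + 1) * |a (n + 1)|) := by ring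
      _ ≤ R ^ n * (1 / (n.factorial : ℝ)) := by gcongr
  have key := hasDerivAt_tsum_of_isPreconnected (g := fun k y => a k * y ^ k)
    (g' := fun k y => a k * (k * y ^ (k - 1))) (y := x) (y₀ := 0) hu
    (Metric.isOpen_ball (x := (0 : ℝ)) (ε := R))
    (convex_ball (0 : ℝ) R).isPreconnected
    (fun n y _ => (hasDerivAt_pow n y).const_mul (a n)) (fun n y hy => ?_)
    (Metric.mem_ball_self hR) (summable_powSum ha 0) (by simp [R])
  · have hs : Summable fun k : ℕ => a k * (k * x ^ (k - 1)) := by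
      rw [← summable_nat_add_iff 1]
      refine (summable_powSum (abs_derivCoeff_le ha) x).congr fun k => ?_
      simp [derivCoeff]; ring
    refine key.congr_deriv ?_
    rw [hs.tsum_eq_zero_add]
    simp only [powSum, derivCoeff, Nat.cast_zero, zero_mul, mul_zero, zero_add]
    refine tsum_congr fun k => ?_
    push_cast; ring
  · have hy' : |y| ≤ R := by
      have := Metric.mem_ball.1 hy
      rw [dist_zero_right] at this
      exact this.le
    rw [Real.norm_eq_abs, abs_mul, abs_mul, abs_pow, Nat.abs_cast]
    gcongr

theorem mul_powSum_derivCoeff_add {a : ℕ → ℝ} (ha : ∀ k, |a k| ≤ 1 / (k.factorial : ℝ)) (x : ℝ) :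
    x * powSum (derivCoeff (derivCoeff a)) x + powSum (derivCoeff a) x =
      ∑' k : ℕ, ((k : ℝ) + 1) ^ 2 * a (k + 1) * x ^ k := by
  have h1 := summable_powSum (abs_derivCoeff_le ha) x
  have h2 := (summable_powSum (abs_derivCoeff_le (abs_derivCoeff_le ha)) x).mul_left x
  have h3 : Summable fun k : ℕ => ((k + 1 : ℕ) : ℝ) * derivCoeff a (k + 1) * x ^ (k + 1) :=
    h2.congr fun k => by simp only [derivCoeff]; push_cast; ring
  have h4 : Summable fun k : ℕ => (k : ℝ) * derivCoeff a k * x ^ k :=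
    (summable_nat_add_iff 1).1 h3
  have h5 : x * powSum (derivCoeff (derivCoeff a)) x
      = ∑' k : ℕ, (k : ℝ) * derivCoeff a k * x ^ k := by
    rw [h4.tsum_eq_zero_add, powSum, ← tsum_mul_left]
    simp only [Nat.cast_zero, zero_mul, zero_add]
    refine tsum_congr fun k => ?_
    simp only [derivCoeff]; push_cast; ring
  rw [h5, powSum, ← h4.tsum_add h1]
  refine tsum_congr fun k => ?_
  simp only [derivCoeff]; ring

/-- The coefficients of `J₀` as a power series in `t²`. -/
noncomputable def besselJCoeff (k : ℕ) : ℝ := (-(1 / 4)) ^ k / (k.factorial : ℝ) ^ 2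

/-- The coefficients of the regular part of `Y₀` as a power series in `t²`. -/
noncomputable def besselYCoeff (k : ℕ) : ℝ := psiInt (k + 1) * besselJCoeff k

theorem abs_besselJCoeff (k : ℕ) :
    |besselJCoeff k| = 1 / (k.factorial : ℝ) * (1 / (4 ^ k * k.factorial)) := by
  rw [besselJCoeff, abs_div, abs_pow, abs_neg, abs_of_pos (by norm_num : (0 : ℝ) < 1 / 4),
    abs_of_pos (by positivity : (0 : ℝ) < (k.factorial : ℝ) ^ 2)]
  field_simp
  rw [← mul_pow]; norm_num

theorem abs_psiInt_le (k : ℕ) : |psiInt (k + 1)| ≤ k + 1 := by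
  have h0 := Real.one_half_lt_eulerMascheroniConstant
  have h1 := Real.eulerMascheroniConstant_lt_two_thirds
  have h2 : ∑ j ∈ Finset.range k, 1 / (j + 1 : ℝ) ≤ k := by
    calc ∑ j ∈ Finset.range k, 1 / (j + 1 : ℝ) ≤ ∑ j ∈ Finset.range k, (1 : ℝ) := by
          refine Finset.sum_le_sum fun j _ => ?_
          rw [div_le_one (by positivity)]
          linarith [(Nat.cast_nonneg j : (0 : ℝ) ≤ j)]
      _ = k := by simp
  have h3 : 0 ≤ ∑ j ∈ Finset.range k, 1 / (j + 1 : ℝ) :=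
    Finset.sum_nonneg fun j _ => by positivity
  rw [psiInt, Nat.add_sub_cancel, abs_le]
  constructor <;> linarith [(Nat.cast_nonneg k : (0 : ℝ) ≤ k)]

theorem natCast_add_one_le_four_pow (k : ℕ) : (k : ℝ) + 1 ≤ 4 ^ k * k.factorial := by
  have h : k + 1 ≤ 4 ^ k := k.lt_pow_self (by norm_num)
  have h' : (k : ℝ) + 1 ≤ 4 ^ k := by exact_mod_cast h
  have h1 : (1 : ℝ) ≤ k.factorial := by exact_mod_cast Nat.one_le_iff_ne_zero.2 k.factorial_ne_zero
  exact h'.trans (le_mul_of_one_le_right (by positivity) h1)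

theorem abs_besselJCoeff_le (k : ℕ) : |besselJCoeff k| ≤ 1 / (k.factorial : ℝ) := by
  rw [abs_besselJCoeff]
  refine mul_le_of_le_one_right (by positivity) ?_
  rw [div_le_one (by positivity)]
  linarith [natCast_add_one_le_four_pow k, (Nat.cast_nonneg k : (0 : ℝ) ≤ k)]

theorem abs_besselYCoeff_le (k : ℕ) : |besselYCoeff k| ≤ 1 / (k.factorial : ℝ) := by
  rw [besselYCoeff, abs_mul, abs_besselJCoeff, mul_left_comm]
  refine mul_le_of_le_one_right (by positivity) ?_
  rw [mul_one_div, div_le_one (by positivity)]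
  exact (abs_psiInt_le k).trans (natCast_add_one_le_four_pow k)

theorem besselJCoeff_succ (k : ℕ) :
    ((k : ℝ) + 1) ^ 2 * besselJCoeff (k + 1) = -(1 / 4) * besselJCoeff k := by
  rw [besselJCoeff, besselJCoeff, Nat.factorial_succ]
  push_cast
  field_simp
  ring

theorem psiInt_succ (k : ℕ) : psiInt (k + 2) = psiInt (k + 1) + 1 / (k + 1 : ℝ) := by
  simp only [psiInt, Nat.add_sub_cancel, show k + 2 - 1 = k + 1 from rfl, Finset.sum_range_succ]
  ring

theorem besselYCoeff_succ (k : ℕ) :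
    ((k : ℝ) + 1) ^ 2 * besselYCoeff (k + 1) =
      -(1 / 4) * besselYCoeff k + derivCoeff besselJCoeff k := by
  have h := besselJCoeff_succ k
  rw [besselYCoeff, besselYCoeff, derivCoeff, psiInt_succ, mul_left_comm, h, add_mul]
  have : derivCoeff besselJCoeff k = 1 / (k + 1 : ℝ) * ((k + 1) ^ 2 * besselJCoeff (k + 1)) := by
    rw [derivCoeff]; field_simp
  rw [derivCoeff] at this
  rw [this, h]; ring

theorem powSum_besselJCoeff_ode (x : ℝ) :
    x * powSum (derivCoeff (derivCoeff besselJCoeff)) x + powSum (derivCoeff besselJCoeff) x =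
      -(1 / 4) * powSum besselJCoeff x := by
  rw [mul_powSum_derivCoeff_add abs_besselJCoeff_le, powSum, ← tsum_mul_left]
  refine tsum_congr fun k => ?_
  rw [besselJCoeff_succ, mul_assoc]

theorem powSum_besselYCoeff_ode (x : ℝ) :
    x * powSum (derivCoeff (derivCoeff besselYCoeff)) x + powSum (derivCoeff besselYCoeff) x =
      -(1 / 4) * powSum besselYCoeff x + powSum (derivCoeff besselJCoeff) x := by
  rw [mul_powSum_derivCoeff_add abs_besselYCoeff_le, powSum, powSum, ← tsum_mul_left,
    ← ((summable_powSum abs_besselYCoeff_le x).mul_left _).tsum_add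
      (summable_powSum (abs_derivCoeff_le abs_besselJCoeff_le) x)]
  refine tsum_congr fun k => ?_
  rw [besselYCoeff_succ]; ring

/-- `J₀` as a function of a real variable. -/
noncomputable def realBesselJ (t : ℝ) : ℝ := powSum besselJCoeff (t ^ 2)

/-- `t` times the derivative of `realBesselJ`. -/
noncomputable def mulDerivBesselJ (t : ℝ) : ℝ :=
  2 * t ^ 2 * powSum (derivCoeff besselJCoeff) (t ^ 2)

/-- The regular part of `Y₀`: the series with digamma factors. -/
noncomputable def psiSeries (t : ℝ) : ℝ := powSum besselYCoeff (t ^ 2)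

/-- `t` times the derivative of `psiSeries`. -/
noncomputable def mulDerivPsiSeries (t : ℝ) : ℝ :=
  2 * t ^ 2 * powSum (derivCoeff besselYCoeff) (t ^ 2)

/-- `(π / 2) Y₀` as a function of a real variable. -/
noncomputable def realBesselY (t : ℝ) : ℝ := Real.log (t / 2) * realBesselJ t - psiSeries t

/-- `t` times the derivative of `realBesselY`. -/
noncomputable def mulDerivBesselY (t : ℝ) : ℝ :=
  realBesselJ t + Real.log (t / 2) * mulDerivBesselJ t - mulDerivPsiSeries t

theorem hasDerivAt_powSum_sq {a : ℕ → ℝ} (ha : ∀ k, |a k| ≤ 1 / (k.factorial : ℝ)) (t : ℝ) :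
    HasDerivAt (fun t => powSum a (t ^ 2)) (2 * t * powSum (derivCoeff a) (t ^ 2)) t := by
  have h := (hasDerivAt_powSum ha (t ^ 2)).comp t (hasDerivAt_pow 2 t)
  refine h.congr_deriv ?_
  push_cast; ring

theorem continuous_powSum_sq {a : ℕ → ℝ} (ha : ∀ k, |a k| ≤ 1 / (k.factorial : ℝ)) :
    Continuous fun t => powSum a (t ^ 2) :=
  continuous_iff_continuousAt.2 fun t => (hasDerivAt_powSum_sq ha t).continuousAt

theorem hasDerivAt_mul_powSum_sq {a : ℕ → ℝ} (ha : ∀ k, |a k| ≤ 1 / (k.factorial : ℝ)) (t : ℝ) :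
    HasDerivAt (fun t => 2 * t ^ 2 * powSum (derivCoeff a) (t ^ 2))
      (4 * t * (t ^ 2 * powSum (derivCoeff (derivCoeff a)) (t ^ 2)
        + powSum (derivCoeff a) (t ^ 2))) t := by
  have h := ((hasDerivAt_pow 2 t).const_mul 2).mul (hasDerivAt_powSum_sq (abs_derivCoeff_le ha) t)
  refine h.congr_deriv ?_
  push_cast; ring

theorem hasDerivAt_realBesselJ {t : ℝ} (ht : 0 < t) :
    HasDerivAt realBesselJ (mulDerivBesselJ t / t) t := by
  refine (hasDerivAt_powSum_sq abs_besselJCoeff_le t).congr_deriv ?_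
  rw [mulDerivBesselJ]; field_simp

theorem hasDerivAt_mulDerivBesselJ (t : ℝ) :
    HasDerivAt mulDerivBesselJ (-(t * realBesselJ t)) t := by
  refine (hasDerivAt_mul_powSum_sq abs_besselJCoeff_le t).congr_deriv ?_
  rw [powSum_besselJCoeff_ode, realBesselJ]; ring

theorem hasDerivAt_log_div_two {t : ℝ} (ht : 0 < t) :
    HasDerivAt (fun t => Real.log (t / 2)) (1 / t) t := by
  refine (((hasDerivAt_id' t).div_const 2).log (by positivity)).congr_deriv ?_
  field_simp

theorem hasDerivAt_realBesselY {t : ℝ} (ht : 0 < t) :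
    HasDerivAt realBesselY (mulDerivBesselY t / t) t := by
  have h := ((hasDerivAt_log_div_two ht).mul (hasDerivAt_realBesselJ ht)).sub
    (hasDerivAt_powSum_sq abs_besselYCoeff_le t)
  refine h.congr_deriv ?_
  rw [mulDerivBesselY, mulDerivPsiSeries]; field_simp

theorem hasDerivAt_mulDerivBesselY {t : ℝ} (ht : 0 < t) :
    HasDerivAt mulDerivBesselY (-(t * realBesselY t)) t := by
  have h := ((hasDerivAt_realBesselJ ht).add ((hasDerivAt_log_div_two ht).mul
    (hasDerivAt_mulDerivBesselJ t))).sub (hasDerivAt_mul_powSum_sq abs_besselYCoeff_le t)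
  refine h.congr_deriv ?_
  rw [powSum_besselYCoeff_ode, realBesselY, psiSeries, mulDerivBesselJ]; field_simp; ring

theorem hankelH_zero_ofReal {t : ℝ} (ht : 0 ≤ t) :
    hankelH 0 (t : ℂ) = realBesselJ t + Complex.I * ((2 / Real.pi * realBesselY t : ℝ) : ℂ) := by
  have hJ : besselJ 0 (t : ℂ) = (realBesselJ t : ℂ) := by
    rw [besselJ, realBesselJ, powSum, Complex.ofReal_tsum, pow_zero, one_mul]
    refine tsum_congr fun k => ?_
    rw [besselJCoeff]
    push_cast
    rw [zero_add, ← pow_mul]; ring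
  have hB : ∑' k : ℕ, ((psiInt (k + 1) + psiInt (0 + k + 1) : ℝ) : ℂ) * (-(1/4 : ℂ)) ^ k *
      (t : ℂ) ^ (2 * k) / ((Nat.factorial k : ℂ) * (Nat.factorial (0 + k) : ℂ))
      = ((2 * psiSeries t : ℝ) : ℂ) := by
    rw [psiSeries, powSum, ← tsum_mul_left, Complex.ofReal_tsum]
    refine tsum_congr fun k => ?_
    rw [besselYCoeff, besselJCoeff]
    push_cast
    rw [zero_add, ← pow_mul]; ring
  have hlog : Complex.log ((t : ℂ) / 2) = (Real.log (t / 2) : ℂ) := by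
    rw [Complex.ofReal_log (by positivity)]; push_cast; rfl
  have hY : besselY 0 (t : ℂ) = ((2 / Real.pi * realBesselY t : ℝ) : ℂ) := by
    rw [besselY, hB, hJ, hlog, realBesselY]
    push_cast
    simp; ring
  simp [hankelH, hJ, hY]

theorem integrableOn_pow_mul_exp_neg (n : ℕ) {t : ℝ} (ht : 0 < t) :
    IntegrableOn (fun s : ℝ => s ^ n * Real.exp (-(t * s))) (Set.Ioi 0) := by
  have h := integrableOn_rpow_mul_exp_neg_mul_rpow (p := 1) (s := (n : ℝ)) (b := t)
    (by linarith [(Nat.cast_nonneg n : (0 : ℝ) ≤ n)]) one_pos ht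
  refine h.congr_fun (fun s _ => ?_) measurableSet_Ioi
  simp

theorem integral_mul_exp_neg_mul {t : ℝ} (ht : 0 < t) :
    t * ∫ s in Set.Ioi (0 : ℝ), Real.exp (-(t * s)) = 1 := by
  have h := integral_exp_mul_Ioi (a := -t) (by linarith) 0
  simp only [neg_mul] at h
  rw [h]; simp; field_simp

theorem integrableOn_exp_neg_mul_of_le {g : ℝ → ℝ} (hg : Continuous g)
    (hb : ∀ s, 0 < s → |g s| ≤ 1 + s) {t : ℝ} (ht : 0 < t) :
    IntegrableOn (fun s => Real.exp (-(t * s)) * g s) (Set.Ioi 0) := by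
  refine Integrable.mono' ((integrableOn_pow_mul_exp_neg 0 ht).add
    (integrableOn_pow_mul_exp_neg 1 ht)) (by fun_prop) ?_
  refine (ae_restrict_mem measurableSet_Ioi).mono fun s hs => ?_
  rw [Real.norm_eq_abs, abs_mul, Real.abs_exp]
  calc Real.exp (-(t * s)) * |g s| ≤ Real.exp (-(t * s)) * (1 + s) := by gcongr; exact hb s hs
    _ = _ := by simp; ring

theorem hasDerivAt_integral_exp_neg_mul {g : ℝ → ℝ} (hg : Continuous g) (hb : ∀ s, |g s| ≤ 1)
    {t : ℝ} (ht : 0 < t) :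
    HasDerivAt (fun t => ∫ s in Set.Ioi (0 : ℝ), Real.exp (-(t * s)) * g s)
      (-∫ s in Set.Ioi (0 : ℝ), Real.exp (-(t * s)) * (s * g s)) t := by
  have key := hasDerivAt_integral_of_dominated_loc_of_deriv_le (𝕜 := ℝ)
    (μ := volume.restrict (Set.Ioi (0 : ℝ)))
    (F := fun t s => Real.exp (-(t * s)) * g s)
    (F' := fun t s => -(Real.exp (-(t * s)) * (s * g s)))
    (bound := fun s => s ^ 1 * Real.exp (-(t / 2 * s)))
    (x₀ := t) (Ioi_mem_nhds (half_lt_self ht))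
    (Eventually.of_forall fun x => by fun_prop)
    (integrableOn_exp_neg_mul_of_le hg (fun s hs => (hb s).trans (by linarith)) ht)
    (by fun_prop) ?_ (integrableOn_pow_mul_exp_neg 1 (half_pos ht)) ?_
  · refine key.2.congr_deriv (integral_neg _)
  · refine (ae_restrict_mem measurableSet_Ioi).mono fun s (hs : 0 < s) x (hx : t / 2 < x) => ?_
    rw [Real.norm_eq_abs, abs_neg, abs_mul, abs_mul, Real.abs_exp, abs_of_pos hs, pow_one, mul_comm]
    have : Real.exp (-(x * s)) ≤ Real.exp (-(t / 2 * s)) := by gcongr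
    gcongr
    exact mul_le_of_le_one_right hs.le (hb s)
  · refine Eventually.of_forall fun s x _ => ?_
    have h := (((hasDerivAt_id' x).mul_const s).neg.exp).mul_const (g s)
    refine h.congr_deriv ?_
    simp only [Pi.neg_apply]; ring

theorem mul_integral_exp_neg_mul {g g' : ℝ → ℝ} (hd : ∀ s, HasDerivAt g (g' s) s)
    (hg' : Continuous g') (hb : ∀ s, 0 < s → |g s| ≤ 1 + s) (hb' : ∀ s, 0 < s → |g' s| ≤ 1 + s)
    {t : ℝ} (ht : 0 < t) :
    t * ∫ s in Set.Ioi (0 : ℝ), Real.exp (-(t * s)) * g s =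
      g 0 + ∫ s in Set.Ioi (0 : ℝ), Real.exp (-(t * s)) * g' s := by
  have hg : Continuous g := continuous_iff_continuousAt.2 fun s => (hd s).continuousAt
  have i1 := integrableOn_exp_neg_mul_of_le hg hb ht
  have i2 := integrableOn_exp_neg_mul_of_le hg' hb' ht
  have hlim : Tendsto (fun s => Real.exp (-(t * s)) * g s) atTop (nhds 0) := by
    have h0 : Tendsto (fun s : ℝ => s ^ (0 : ℝ) * Real.exp (-t * s)
        + s ^ (1 : ℝ) * Real.exp (-t * s)) atTop (nhds (0 + 0)) :=
      (tendsto_rpow_mul_exp_neg_mul_atTop_nhds_zero 0 t ht).add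
        (tendsto_rpow_mul_exp_neg_mul_atTop_nhds_zero 1 t ht)
    rw [add_zero] at h0
    refine squeeze_zero_norm' ?_ h0
    filter_upwards [eventually_gt_atTop 0] with s hs
    rw [Real.norm_eq_abs, abs_mul, Real.abs_exp, Real.rpow_zero, Real.rpow_one, neg_mul]
    nlinarith [hb s hs, Real.exp_pos (-(t * s))]
  have key := integral_Ioi_of_hasDerivAt_of_tendsto' (a := 0)
    (f := fun s => Real.exp (-(t * s)) * g s)
    (f' := fun s => Real.exp (-(t * s)) * g' s - t * (Real.exp (-(t * s)) * g s))
    (fun s _ => by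
      have h := (((hasDerivAt_id' s).const_mul t).neg.exp).mul (hd s)
      refine h.congr_deriv ?_
      simp only [Pi.neg_apply]; ring) (i2.sub (i1.const_mul t)) hlim
  rw [integral_sub i2 (i1.const_mul t), integral_const_mul] at key
  simp at key
  linarith

/-- The derivative of `arsinh`. -/
noncomputable def invSqrtOneAddSq (s : ℝ) : ℝ := (√(1 + s ^ 2))⁻¹

theorem invSqrtOneAddSq_pos (s : ℝ) : 0 < invSqrtOneAddSq s := by
  unfold invSqrtOneAddSq; positivity

theorem one_le_sqrt_one_add_sq (s : ℝ) : 1 ≤ √(1 + s ^ 2) :=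
  Real.one_le_sqrt.2 (by nlinarith [sq_nonneg s])

theorem invSqrtOneAddSq_le_one (s : ℝ) : invSqrtOneAddSq s ≤ 1 :=
  inv_le_one_of_one_le₀ (one_le_sqrt_one_add_sq s)

theorem continuous_invSqrtOneAddSq : Continuous invSqrtOneAddSq := by
  unfold invSqrtOneAddSq
  exact Continuous.inv₀ (by fun_prop) fun s => by positivity

theorem sq_mul_invSqrtOneAddSq (s : ℝ) : (1 + s ^ 2) * invSqrtOneAddSq s ^ 2 = 1 := by
  rw [invSqrtOneAddSq, inv_pow, Real.sq_sqrt (by positivity)]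
  field_simp

theorem abs_mul_invSqrtOneAddSq_le_one (s : ℝ) : |s * invSqrtOneAddSq s| ≤ 1 := by
  rw [← sq_le_one_iff_abs_le_one]
  nlinarith [sq_mul_invSqrtOneAddSq s, sq_nonneg (invSqrtOneAddSq s)]

theorem hasDerivAt_invSqrtOneAddSq (s : ℝ) :
    HasDerivAt invSqrtOneAddSq (-(s * invSqrtOneAddSq s ^ 3)) s := by
  have h := (((hasDerivAt_pow 2 s).const_add 1).sqrt (by positivity)).inv (by positivity)
  refine h.congr_deriv ?_
  rw [invSqrtOneAddSq]
  push_cast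
  field_simp

theorem hasDerivAt_mul_invSqrtOneAddSq (s : ℝ) :
    HasDerivAt (fun s => s * invSqrtOneAddSq s) (invSqrtOneAddSq s ^ 3) s := by
  refine ((hasDerivAt_id' s).mul (hasDerivAt_invSqrtOneAddSq s)).congr_deriv ?_
  linear_combination -invSqrtOneAddSq s * sq_mul_invSqrtOneAddSq s

/-- The solution `π / 2 * (𝐇₀ - Y₀)` of the inhomogeneous Bessel equation with right-hand side `1`,
where `𝐇₀` is the Struve function. -/
noncomputable def struveK (t : ℝ) : ℝ :=
  ∫ s in Set.Ioi (0 : ℝ), Real.exp (-(t * s)) * invSqrtOneAddSq s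

/-- `t` times the derivative of `struveK`. -/
noncomputable def mulDerivStruveK (t : ℝ) : ℝ :=
  -∫ s in Set.Ioi (0 : ℝ), Real.exp (-(t * s)) * invSqrtOneAddSq s ^ 3

theorem abs_invSqrtOneAddSq_pow_le_one (n : ℕ) (s : ℝ) : |invSqrtOneAddSq s ^ n| ≤ 1 := by
  rw [abs_of_nonneg (pow_nonneg (invSqrtOneAddSq_pos s).le n)]
  exact pow_le_one₀ (invSqrtOneAddSq_pos s).le (invSqrtOneAddSq_le_one s)

theorem abs_invSqrtOneAddSq_le_one (s : ℝ) : |invSqrtOneAddSq s| ≤ 1 := by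
  simpa using abs_invSqrtOneAddSq_pow_le_one 1 s

theorem mulDerivStruveK_eq {t : ℝ} (ht : 0 < t) : mulDerivStruveK t =
    -(t * ∫ s in Set.Ioi (0 : ℝ), Real.exp (-(t * s)) * (s * invSqrtOneAddSq s)) := by
  rw [mulDerivStruveK, mul_integral_exp_neg_mul hasDerivAt_mul_invSqrtOneAddSq
    (continuous_invSqrtOneAddSq.pow 3)
    (fun s hs => (abs_mul_invSqrtOneAddSq_le_one s).trans (by linarith))
    (fun s hs => (abs_invSqrtOneAddSq_pow_le_one 3 s).trans (by linarith)) ht]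
  simp

theorem hasDerivAt_struveK {t : ℝ} (ht : 0 < t) :
    HasDerivAt struveK (mulDerivStruveK t / t) t := by
  refine (hasDerivAt_integral_exp_neg_mul continuous_invSqrtOneAddSq
    abs_invSqrtOneAddSq_le_one ht).congr_deriv ?_
  rw [mulDerivStruveK_eq ht]; field_simp

theorem hasDerivAt_mulDerivStruveK {t : ℝ} (ht : 0 < t) :
    HasDerivAt mulDerivStruveK (1 - t * struveK t) t := by
  have h := mul_integral_exp_neg_mul hasDerivAt_invSqrtOneAddSq
    (continuous_id.mul (continuous_invSqrtOneAddSq.pow 3)).neg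
    (fun s hs => (abs_invSqrtOneAddSq_le_one s).trans (by linarith))
    (fun s hs => ?_) ht
  · refine (hasDerivAt_integral_exp_neg_mul (continuous_invSqrtOneAddSq.pow 3)
      (abs_invSqrtOneAddSq_pow_le_one 3) ht).neg.congr_deriv ?_
    rw [struveK, h, ← integral_neg]
    simp only [mul_neg, integral_neg, neg_neg]
    simp [invSqrtOneAddSq]
  · rw [abs_neg, abs_mul, abs_of_pos hs]
    nlinarith [abs_invSqrtOneAddSq_pow_le_one 3 s]

theorem struveK_nonneg (t : ℝ) : 0 ≤ struveK t :=
  integral_nonneg fun s => mul_nonneg (Real.exp_pos _).le (invSqrtOneAddSq_pos s).le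

theorem integrableOn_exp_neg_mul {t : ℝ} (ht : 0 < t) :
    IntegrableOn (fun s : ℝ => Real.exp (-(t * s))) (Set.Ioi 0) := by
  simpa using integrableOn_pow_mul_exp_neg 0 ht

theorem integrableOn_struveK {t : ℝ} (ht : 0 < t) :
    IntegrableOn (fun s : ℝ => Real.exp (-(t * s)) * invSqrtOneAddSq s) (Set.Ioi 0) :=
  integrableOn_exp_neg_mul_of_le continuous_invSqrtOneAddSq
    (fun s hs => (abs_invSqrtOneAddSq_le_one s).trans (by linarith)) ht

theorem mul_struveK_le_one {t : ℝ} (ht : 0 < t) : t * struveK t ≤ 1 := by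
  rw [← integral_mul_exp_neg_mul ht, struveK]
  refine mul_le_mul_of_nonneg_left (setIntegral_mono (integrableOn_struveK ht)
    (integrableOn_exp_neg_mul ht) fun s => ?_) ht.le
  exact mul_le_of_le_one_right (Real.exp_pos _).le (invSqrtOneAddSq_le_one s)

theorem mulDerivStruveK_nonpos (t : ℝ) : mulDerivStruveK t ≤ 0 :=
  neg_nonpos.2 <| integral_nonneg fun s =>
    mul_nonneg (Real.exp_pos _).le (pow_nonneg (invSqrtOneAddSq_pos s).le 3)

theorem one_add_mulDerivStruveK {t : ℝ} (ht : 0 < t) : 1 + mulDerivStruveK t =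
    t * ∫ s in Set.Ioi (0 : ℝ), Real.exp (-(t * s)) * (1 - s * invSqrtOneAddSq s) := by
  have hi : IntegrableOn (fun s : ℝ => Real.exp (-(t * s)) * (s * invSqrtOneAddSq s))
      (Set.Ioi 0) :=
    integrableOn_exp_neg_mul_of_le (continuous_id.mul continuous_invSqrtOneAddSq)
      (fun s hs => (abs_mul_invSqrtOneAddSq_le_one s).trans (by linarith)) ht
  simp only [mul_sub, mul_one]
  rw [integral_sub (integrableOn_exp_neg_mul ht) hi, mul_sub, integral_mul_exp_neg_mul ht,
    mulDerivStruveK_eq ht]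
  ring

theorem one_add_mulDerivStruveK_nonneg {t : ℝ} (ht : 0 < t) : 0 ≤ 1 + mulDerivStruveK t := by
  rw [one_add_mulDerivStruveK ht]
  refine mul_nonneg ht.le (integral_nonneg fun s => mul_nonneg (Real.exp_pos _).le ?_)
  exact sub_nonneg.2 (le_of_abs_le (abs_mul_invSqrtOneAddSq_le_one s))

theorem one_sub_mul_invSqrtOneAddSq_le {s : ℝ} (hs : 0 < s) :
    1 - s * invSqrtOneAddSq s ≤ invSqrtOneAddSq s := by
  have h : √(1 + s ^ 2) ≤ 1 + s := Real.sqrt_le_iff.2 ⟨by linarith, by nlinarith⟩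
  have h2 : √(1 + s ^ 2) * invSqrtOneAddSq s = 1 := mul_inv_cancel₀ (by positivity)
  nlinarith [invSqrtOneAddSq_pos s]

theorem one_add_mulDerivStruveK_le {t : ℝ} (ht : 0 < t) :
    1 + mulDerivStruveK t ≤ t * struveK t := by
  rw [one_add_mulDerivStruveK ht, struveK]
  refine mul_le_mul_of_nonneg_left (setIntegral_mono_on ?_ (integrableOn_struveK ht)
    measurableSet_Ioi fun s hs => ?_) ht.le
  · refine integrableOn_exp_neg_mul_of_le
      (continuous_const.sub (continuous_id.mul continuous_invSqrtOneAddSq)) (fun s hs => ?_) ht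
    have h1 := le_of_abs_le (abs_mul_invSqrtOneAddSq_le_one s)
    have h2 := mul_pos hs (invSqrtOneAddSq_pos s)
    change |1 - s * invSqrtOneAddSq s| ≤ 1 + s
    rw [abs_of_nonneg (by linarith)]; linarith
  · gcongr
    exact one_sub_mul_invSqrtOneAddSq_le hs

theorem integral_log_mul_exp_neg :
    ∫ u in Set.Ioi (0 : ℝ), Real.exp (-u) * Real.log u = -Real.eulerMascheroniConstant := by
  have h := Complex.hasDerivAt_GammaIntegral (s := 1) (by simp)
  have h1 : HasDerivAt Complex.GammaIntegral (-(Real.eulerMascheroniConstant : ℂ)) 1 := by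
    refine Complex.hasDerivAt_Gamma_one.congr_of_eventuallyEq ?_
    filter_upwards [Complex.continuous_re.continuousAt.eventually
      (Ioi_mem_nhds (show (0 : ℝ) < (1 : ℂ).re by simp))] with s hs
    exact (Complex.Gamma_eq_integral hs).symm
  have h2 := h.unique h1
  simp only [sub_self, Complex.cpow_zero, one_mul] at h2
  have h3 : ∫ u in Set.Ioi (0 : ℝ), ((Real.exp (-u) * Real.log u : ℝ) : ℂ)
      = ((-Real.eulerMascheroniConstant : ℝ) : ℂ) := by
    push_cast
    rw [← h2]
    refine integral_congr_ae (Eventually.of_forall fun u => ?_)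
    simp [mul_comm]
  rw [integral_complex_ofReal] at h3
  exact_mod_cast h3

theorem integrableOn_exp_neg_mul_log :
    IntegrableOn (fun u : ℝ => Real.exp (-u) * Real.log u) (Set.Ioi 0) := by
  by_contra h
  have h1 := integral_log_mul_exp_neg
  rw [integral_undef h] at h1
  linarith [Real.one_half_lt_eulerMascheroniConstant]

theorem arsinh_le_self {s : ℝ} (hs : 0 ≤ s) : Real.arsinh s ≤ s := by
  rw [← Real.sinh_le_sinh, Real.sinh_arsinh]
  exact Real.self_le_sinh_iff.2 hs

theorem struveK_eq_integral_arsinh {t : ℝ} (ht : 0 < t) :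
    struveK t = ∫ u in Set.Ioi (0 : ℝ), Real.exp (-u) * Real.arsinh (u / t) := by
  have h := mul_integral_exp_neg_mul Real.hasDerivAt_arsinh continuous_invSqrtOneAddSq
    (fun s hs => ?_) (fun s hs => (abs_invSqrtOneAddSq_le_one s).trans (by linarith)) ht
  · rw [Real.arsinh_zero, zero_add] at h
    have h2 := integral_comp_mul_left_Ioi
      (fun u => Real.exp (-u) * Real.arsinh (u / t)) 0 ht
    simp only [mul_zero, mul_div_cancel_left₀ _ ht.ne'] at h2
    rw [h2, smul_eq_mul, mul_inv_cancel_left₀ ht.ne'] at h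
    exact h.symm
  · rw [abs_of_nonneg (Real.arsinh_nonneg_iff.2 hs.le)]
    linarith [arsinh_le_self hs.le]

theorem struveK_add_log {t : ℝ} (ht : 0 < t) : struveK t + Real.log (t / 2) =
    ∫ u in Set.Ioi (0 : ℝ), Real.exp (-u) * Real.log ((u + √(t ^ 2 + u ^ 2)) / 2) := by
  have he := integrableOn_exp_neg_mul one_pos
  have h1 := integral_mul_exp_neg_mul one_pos
  simp only [one_mul] at he h1
  have hi : IntegrableOn (fun u : ℝ => Real.exp (-u) * Real.arsinh (u / t)) (Set.Ioi 0) := by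
    refine Integrable.mono' ((integrableOn_pow_mul_exp_neg 1 one_pos).const_mul t⁻¹)
      (Continuous.aestronglyMeasurable ((by fun_prop : Continuous fun u : ℝ => Real.exp (-u)).mul
        (Real.continuous_arsinh.comp (by fun_prop)))) ?_
    refine (ae_restrict_mem measurableSet_Ioi).mono fun u (hu : 0 < u) => ?_
    have h0 : 0 ≤ u / t := by positivity
    rw [Real.norm_eq_abs, abs_mul, Real.abs_exp, abs_of_nonneg (Real.arsinh_nonneg_iff.2 h0)]
    calc Real.exp (-u) * Real.arsinh (u / t) ≤ Real.exp (-u) * (u / t) := by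
          gcongr; exact arsinh_le_self h0
      _ = _ := by rw [one_mul]; field_simp
  rw [struveK_eq_integral_arsinh ht]
  nth_rewrite 1 [← one_mul (Real.log (t / 2))]
  rw [← h1, ← integral_mul_const, ← integral_add hi (he.mul_const _)]
  refine setIntegral_congr_fun measurableSet_Ioi fun u (hu : 0 < u) => ?_
  have hs : 0 < u + √(t ^ 2 + u ^ 2) := by positivity
  have h2 : u / t + √(1 + (u / t) ^ 2) = (u + √(t ^ 2 + u ^ 2)) / t := by
    have : t ^ 2 + u ^ 2 = t ^ 2 * (1 + (u / t) ^ 2) := by field_simp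
    rw [this, Real.sqrt_mul (by positivity), Real.sqrt_sq ht.le]; field_simp
  rw [← mul_add, Real.arsinh, h2, ← Real.log_mul (by positivity) (by positivity)]
  congr 2
  field_simp

theorem tendsto_struveK_add_log : Tendsto (fun t => struveK t + Real.log (t / 2))
    (nhdsWithin 0 (Set.Ioi 0)) (nhds (-Real.eulerMascheroniConstant)) := by
  rw [← integral_log_mul_exp_neg]
  have key : Tendsto (fun t => ∫ u in Set.Ioi (0 : ℝ),
      Real.exp (-u) * Real.log ((u + √(t ^ 2 + u ^ 2)) / 2)) (nhdsWithin 0 (Set.Ioi 0))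
      (nhds (∫ u in Set.Ioi (0 : ℝ), Real.exp (-u) * Real.log u)) := by
    refine tendsto_integral_filter_of_dominated_convergence
      (fun u => |Real.exp (-u) * Real.log u| + u ^ 1 * Real.exp (-(1 * u))) ?_ ?_ ?_ ?_
    · refine Eventually.of_forall fun t => Measurable.aestronglyMeasurable ?_
      fun_prop
    · filter_upwards [Ioo_mem_nhdsGT (one_pos (α := ℝ))] with t ht
      refine (ae_restrict_mem measurableSet_Ioi).mono fun u (hu : 0 < u) => ?_
      have h1 : u ≤ √(t ^ 2 + u ^ 2) := Real.le_sqrt_of_sq_le (by nlinarith [sq_nonneg t])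
      have h2 : √(t ^ 2 + u ^ 2) ≤ 1 + u :=
        Real.sqrt_le_iff.2 ⟨by linarith, by nlinarith [ht.1, ht.2]⟩
      have h3 : Real.log u ≤ Real.log ((u + √(t ^ 2 + u ^ 2)) / 2) :=
        Real.log_le_log hu (by linarith)
      have h4 : Real.log ((u + √(t ^ 2 + u ^ 2)) / 2) ≤ u := by
        refine (Real.log_le_sub_one_of_pos (by linarith)).trans (by linarith)
      have h5 : |Real.log ((u + √(t ^ 2 + u ^ 2)) / 2)| ≤ |Real.log u| + u :=
        abs_le.2 ⟨by linarith [neg_abs_le (Real.log u)], by linarith [abs_nonneg (Real.log u)]⟩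
      rw [Real.norm_eq_abs, abs_mul, abs_mul, Real.abs_exp]
      calc _ ≤ Real.exp (-u) * (|Real.log u| + u) := by gcongr
        _ = _ := by rw [one_mul, pow_one]; ring
    · exact integrableOn_exp_neg_mul_log.abs.add (integrableOn_pow_mul_exp_neg 1 one_pos)
    · refine (ae_restrict_mem measurableSet_Ioi).mono fun u (hu : 0 < u) => ?_
      refine Tendsto.mono_left ?_ nhdsWithin_le_nhds
      have hc : ContinuousAt (fun t : ℝ => Real.exp (-u) *
          Real.log ((u + √(t ^ 2 + u ^ 2)) / 2)) 0 := by
        refine ContinuousAt.mul continuousAt_const (ContinuousAt.log (by fun_prop) ?_)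
        positivity
      have h := hc.tendsto
      rw [show (u + √((0 : ℝ) ^ 2 + u ^ 2)) / 2 = u by
        rw [zero_pow two_ne_zero, zero_add, Real.sqrt_sq hu.le]; ring] at h
      exact h
  refine key.congr' ?_
  filter_upwards [self_mem_nhdsWithin] with t ht
  exact (struveK_add_log ht).symm

theorem tendsto_zero_of_bessel_ode {y P : ℝ → ℝ} (hy : ∀ t, 0 < t → HasDerivAt y (P t / t) t)
    (hP : ∀ t, 0 < t → HasDerivAt P (-(t * y t)) t) :
    Tendsto y atTop (nhds 0) ∧ Tendsto (fun t => P t / t) atTop (nhds 0) := by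
  set E : ℝ → ℝ := fun t => P t ^ 2 / t + t * y t ^ 2 + y t * P t / t + y t ^ 2 / (2 * t) with hE
  have hd : ∀ t, 0 < t → HasDerivAt E (-(y t ^ 2 / (2 * t ^ 2))) t := fun t ht => by
    have h := ((((hP t ht).pow 2).div (hasDerivAt_id' t) ht.ne').add
      ((hasDerivAt_id' t).mul ((hy t ht).pow 2))).add
      (((hy t ht).mul (hP t ht)).div (hasDerivAt_id' t) ht.ne') |>.add
      (((hy t ht).pow 2).div ((hasDerivAt_id' t).const_mul 2) (by positivity))
    refine h.congr_deriv ?_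
    simp only [Pi.pow_apply, Pi.mul_apply]
    field_simp
    push_cast
    ring
  have hanti : AntitoneOn E (Set.Ici 1) := by
    refine antitoneOn_of_deriv_nonpos (convex_Ici 1)
      (fun t ht => (hd t (one_pos.trans_le ht)).continuousAt.continuousWithinAt)
      (fun t ht => ?_) fun t ht => ?_
    · rw [interior_Ici] at ht
      exact (hd t (one_pos.trans ht)).differentiableAt.differentiableWithinAt
    · rw [interior_Ici] at ht
      rw [(hd t (one_pos.trans ht)).deriv]
      exact neg_nonpos.2 (by positivity)
  have hb : ∀ t, 1 ≤ t → y t ^ 2 + (P t / t) ^ 2 ≤ 2 * E 1 / t := fun t ht => by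
    have ht0 : 0 < t := one_pos.trans_le ht
    have h1 : E t ≤ E 1 := hanti Set.self_mem_Ici ht ht
    have h2 : E t = t * (y t ^ 2 + (P t / t) ^ 2) + y t * (P t / t) + y t ^ 2 / (2 * t) := by
      simp only [hE]; field_simp; ring
    have h3 : 0 ≤ y t ^ 2 / (2 * t) := by positivity
    rw [le_div_iff₀ ht0]
    nlinarith [sq_nonneg (y t + P t / t), mul_nonneg (sub_nonneg.2 ht) (sq_nonneg (y t)),
      mul_nonneg (sub_nonneg.2 ht) (sq_nonneg (P t / t))]
  have hlim : Tendsto (fun t => √(2 * E 1 / t)) atTop (nhds 0) := by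
    have h := (tendsto_const_nhds (x := 2 * E 1)).div_atTop (tendsto_id (α := ℝ))
    simpa using h.sqrt
  constructor
  · refine squeeze_zero_norm' ?_ hlim
    filter_upwards [eventually_ge_atTop 1] with t ht
    exact Real.abs_le_sqrt (by linarith [hb t ht, sq_nonneg (P t / t)])
  · refine squeeze_zero_norm' ?_ hlim
    filter_upwards [eventually_ge_atTop 1] with t ht
    exact Real.abs_le_sqrt (by linarith [hb t ht, sq_nonneg (y t)])

/-- An antiderivative of a solution `y` of the Bessel equation of order zero, where `P` is `t` times
its derivative: the Lagrange bracket of `y` and `struveK`. -/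
noncomputable def struveBracket (y P : ℝ → ℝ) (t : ℝ) : ℝ :=
  mulDerivStruveK t * y t - P t * struveK t

theorem tendsto_integral_of_bessel_ode {y P : ℝ → ℝ} {c : ℝ}
    (hy : ∀ t, 0 < t → HasDerivAt y (P t / t) t)
    (hP : ∀ t, 0 < t → HasDerivAt P (-(t * y t)) t)
    (hint : ∀ T, IntervalIntegrable y volume 0 T)
    (hc : Tendsto (struveBracket y P) (nhdsWithin 0 (Set.Ioi 0)) (nhds c)) :
    Tendsto (fun T => ∫ t in (0 : ℝ)..T, y t) atTop (nhds (-c)) := by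
  have hd : ∀ t, 0 < t → HasDerivAt (struveBracket y P) (y t) t := fun t ht => by
    have h := ((hasDerivAt_mulDerivStruveK ht).mul (hy t ht)).sub
      ((hP t ht).mul (hasDerivAt_struveK ht))
    refine h.congr_deriv ?_
    field_simp; ring
  have heq : ∀ T, 0 < T → ∫ t in (0 : ℝ)..T, y t = struveBracket y P T - c := fun T hT =>
    intervalIntegral.integral_eq_sub_of_hasDerivAt_of_tendsto hT (fun t ht => hd t ht.1) (hint T) hc
      ((hd T hT).continuousAt.tendsto.mono_left nhdsWithin_le_nhds)
  obtain ⟨h1, h2⟩ := tendsto_zero_of_bessel_ode hy hP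
  have hW : Tendsto (struveBracket y P) atTop (nhds 0) := by
    have h3 : Tendsto (fun t => |y t| + |P t / t|) atTop (nhds 0) := by
      simpa using h1.abs.add h2.abs
    refine squeeze_zero_norm' ?_ h3
    filter_upwards [eventually_gt_atTop 0] with t ht
    have hQ : |mulDerivStruveK t| ≤ 1 :=
      abs_le.2 ⟨by linarith [one_add_mulDerivStruveK_nonneg ht],
        by linarith [mulDerivStruveK_nonpos t]⟩
    have hS : |t * struveK t| ≤ 1 := by
      rw [abs_of_nonneg (mul_nonneg ht.le (struveK_nonneg t))]
      exact mul_struveK_le_one ht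
    have he : P t * struveK t = P t / t * (t * struveK t) := by field_simp
    rw [struveBracket, he]
    refine (norm_sub_le _ _).trans ?_
    rw [Real.norm_eq_abs, Real.norm_eq_abs, abs_mul, abs_mul]
    exact add_le_add (mul_le_of_le_one_left (abs_nonneg _) hQ)
      (mul_le_of_le_one_right (abs_nonneg _) hS)
  rw [← zero_sub]
  refine (hW.sub_const c).congr' ?_
  filter_upwards [eventually_gt_atTop 0] with T hT
  exact (heq T hT).symm

theorem tendsto_mul_log_div_two_sq :
    Tendsto (fun t => t * Real.log (t / 2) ^ 2) (nhdsWithin 0 (Set.Ioi 0)) (nhds 0) := by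
  have h1 := tendsto_log_mul_rpow_nhdsGT_zero (r := 1 / 2) (by norm_num)
  have hhalf : Tendsto (fun t : ℝ => t / 2) (nhdsWithin 0 (Set.Ioi 0))
      (nhdsWithin 0 (Set.Ioi 0)) := by
    refine tendsto_nhdsWithin_of_tendsto_nhds_of_eventually_within _ ?_ ?_
    · have : ContinuousAt (fun t : ℝ => t / 2) 0 := by fun_prop
      simpa using this.tendsto.mono_left nhdsWithin_le_nhds
    · filter_upwards [self_mem_nhdsWithin] with t (ht : 0 < t) using half_pos ht
  have h2 := ((h1.comp hhalf).pow 2).const_mul 2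
  rw [zero_pow two_ne_zero, mul_zero] at h2
  refine h2.congr' ?_
  filter_upwards [self_mem_nhdsWithin] with t (ht : 0 < t)
  simp only [Function.comp_apply]
  rw [mul_pow, ← Real.sqrt_eq_rpow, Real.sq_sqrt (by positivity)]
  ring

theorem tendsto_nhdsGT_id : Tendsto (fun t : ℝ => t) (nhdsWithin 0 (Set.Ioi 0)) (nhds 0) :=
  tendsto_id.mono_left nhdsWithin_le_nhds

theorem tendsto_mul_log_div_two :
    Tendsto (fun t => t * Real.log (t / 2)) (nhdsWithin 0 (Set.Ioi 0)) (nhds 0) := by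
  have h : Tendsto (fun t => t + t * Real.log (t / 2) ^ 2) (nhdsWithin 0 (Set.Ioi 0))
      (nhds 0) := by
    simpa using tendsto_nhdsGT_id.add tendsto_mul_log_div_two_sq
  refine squeeze_zero_norm' ?_ h
  filter_upwards [self_mem_nhdsWithin] with t (ht : 0 < t)
  rw [Real.norm_eq_abs, abs_mul, abs_of_pos ht, ← sq_abs (Real.log (t / 2))]
  nlinarith [sq_nonneg (|Real.log (t / 2)| - 1), abs_nonneg (Real.log (t / 2)),
    mul_nonneg ht.le (sq_nonneg (|Real.log (t / 2)| - 1)),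
    mul_nonneg ht.le (abs_nonneg (Real.log (t / 2)))]

theorem tendsto_mul_struveK :
    Tendsto (fun t => t * struveK t) (nhdsWithin 0 (Set.Ioi 0)) (nhds 0) := by
  have h := (tendsto_nhdsGT_id.mul tendsto_struveK_add_log).sub tendsto_mul_log_div_two
  rw [zero_mul, sub_zero] at h
  exact h.congr fun t => by ring

theorem tendsto_mul_struveK_mul_log :
    Tendsto (fun t => t * struveK t * Real.log (t / 2)) (nhdsWithin 0 (Set.Ioi 0)) (nhds 0) := by
  have h := (tendsto_mul_log_div_two.mul tendsto_struveK_add_log).sub tendsto_mul_log_div_two_sq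
  rw [zero_mul, sub_zero] at h
  exact h.congr fun t => by ring

theorem tendsto_mulDerivStruveK :
    Tendsto mulDerivStruveK (nhdsWithin 0 (Set.Ioi 0)) (nhds (-1)) := by
  have h : Tendsto (fun t => 1 + mulDerivStruveK t) (nhdsWithin 0 (Set.Ioi 0)) (nhds 0) := by
    refine squeeze_zero' ?_ ?_ tendsto_mul_struveK
    · filter_upwards [self_mem_nhdsWithin] with t ht using one_add_mulDerivStruveK_nonneg ht
    · filter_upwards [self_mem_nhdsWithin] with t ht using one_add_mulDerivStruveK_le ht
  have h' := h.sub_const 1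
  rw [zero_sub] at h'
  exact h'.congr fun t => by ring

theorem tendsto_one_add_mulDerivStruveK_mul_log :
    Tendsto (fun t => (1 + mulDerivStruveK t) * Real.log (t / 2)) (nhdsWithin 0 (Set.Ioi 0))
      (nhds 0) := by
  have h := tendsto_mul_struveK_mul_log.abs
  rw [abs_zero] at h
  refine squeeze_zero_norm' ?_ h
  filter_upwards [self_mem_nhdsWithin] with t (ht : 0 < t)
  rw [Real.norm_eq_abs, abs_mul, abs_mul, abs_of_nonneg (one_add_mulDerivStruveK_nonneg ht),
    abs_of_nonneg (mul_nonneg ht.le (struveK_nonneg t))]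
  gcongr
  exact one_add_mulDerivStruveK_le ht

theorem tendsto_powSum_sq {a : ℕ → ℝ} (ha : ∀ k, |a k| ≤ 1 / (k.factorial : ℝ)) :
    Tendsto (fun t => powSum a (t ^ 2)) (nhdsWithin 0 (Set.Ioi 0)) (nhds (a 0)) := by
  have h := (continuous_powSum_sq ha).tendsto 0
  have h0 : powSum a ((0 : ℝ) ^ 2) = a 0 := by
    rw [powSum, zero_pow two_ne_zero, tsum_eq_single 0 (fun k hk => by simp [hk])]; simp
  rw [h0] at h
  exact h.mono_left nhdsWithin_le_nhds

theorem tendsto_realBesselJ : Tendsto realBesselJ (nhdsWithin 0 (Set.Ioi 0)) (nhds 1) := by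
  have h := tendsto_powSum_sq abs_besselJCoeff_le
  rwa [show besselJCoeff 0 = 1 by simp [besselJCoeff]] at h

theorem tendsto_psiSeries : Tendsto psiSeries (nhdsWithin 0 (Set.Ioi 0))
    (nhds (-Real.eulerMascheroniConstant)) := by
  have h := tendsto_powSum_sq abs_besselYCoeff_le
  rwa [show besselYCoeff 0 = -Real.eulerMascheroniConstant by
    simp [besselYCoeff, besselJCoeff, psiInt]] at h

theorem tendsto_two_mul_powSum_derivCoeff {a : ℕ → ℝ}
    (ha : ∀ k, |a k| ≤ 1 / (k.factorial : ℝ)) :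
    Tendsto (fun t => 2 * t * powSum (derivCoeff a) (t ^ 2)) (nhdsWithin 0 (Set.Ioi 0))
      (nhds 0) := by
  have h := (tendsto_nhdsGT_id.const_mul 2).mul (tendsto_powSum_sq (abs_derivCoeff_le ha))
  rwa [mul_zero, zero_mul] at h

theorem tendsto_struveBracket_besselJ :
    Tendsto (struveBracket realBesselJ mulDerivBesselJ) (nhdsWithin 0 (Set.Ioi 0)) (nhds (-1)) := by
  have h := (tendsto_mulDerivStruveK.mul tendsto_realBesselJ).sub
    ((tendsto_two_mul_powSum_derivCoeff abs_besselJCoeff_le).mul tendsto_mul_struveK)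
  rw [mul_one, mul_zero, sub_zero] at h
  refine h.congr fun t => ?_
  rw [struveBracket, mulDerivBesselJ]; ring

theorem tendsto_struveBracket_besselY :
    Tendsto (struveBracket realBesselY mulDerivBesselY) (nhdsWithin 0 (Set.Ioi 0)) (nhds 0) := by
  have h1 := tendsto_realBesselJ.mul
    (tendsto_one_add_mulDerivStruveK_mul_log.sub tendsto_struveK_add_log)
  have h2 := tendsto_mulDerivStruveK.mul tendsto_psiSeries
  have h3 := (tendsto_two_mul_powSum_derivCoeff abs_besselJCoeff_le).mul
    tendsto_mul_struveK_mul_log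
  have h4 := (tendsto_two_mul_powSum_derivCoeff abs_besselYCoeff_le).mul tendsto_mul_struveK
  have h := ((h1.sub h2).sub h3).add h4
  simp only [zero_sub, neg_neg, one_mul, neg_mul, mul_zero, add_zero, sub_self] at h
  refine h.congr fun t => ?_
  rw [struveBracket, realBesselY, mulDerivBesselY, mulDerivBesselJ, mulDerivPsiSeries]; ring

theorem intervalIntegrable_realBesselJ (a b : ℝ) : IntervalIntegrable realBesselJ volume a b :=
  (continuous_powSum_sq abs_besselJCoeff_le).intervalIntegrable a b

theorem intervalIntegrable_realBesselY (a b : ℝ) : IntervalIntegrable realBesselY volume a b := by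
  have hlog : IntervalIntegrable (fun t : ℝ => Real.log (t / 2)) volume a b := by
    have h := (intervalIntegral.intervalIntegrable_log' (a := a) (b := b)).sub
      (intervalIntegrable_const (c := Real.log 2))
    refine h.congr_ae ?_
    filter_upwards [ae_restrict_of_ae (Measure.ae_ne volume (0 : ℝ))] with t ht
    rw [Real.log_div ht two_ne_zero]
  exact (hlog.mul_continuousOn (continuous_powSum_sq abs_besselJCoeff_le).continuousOn).sub
    ((continuous_powSum_sq abs_besselYCoeff_le).intervalIntegrable a b)

theorem intervalIntegrable_ofReal {f : ℝ → ℝ} {a b : ℝ} (h : IntervalIntegrable f volume a b) :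
    IntervalIntegrable (fun t => (f t : ℂ)) volume a b :=
  ⟨Integrable.ofReal h.1, Integrable.ofReal h.2⟩

/-- `H₀` on the positive half-axis, in terms of real functions. -/
noncomputable def realHankel (t : ℝ) : ℂ :=
  realBesselJ t + Complex.I * ((2 / Real.pi * realBesselY t : ℝ) : ℂ)

theorem intervalIntegrable_realHankel (a b : ℝ) : IntervalIntegrable realHankel volume a b :=
  (intervalIntegrable_ofReal (intervalIntegrable_realBesselJ a b)).add
    ((intervalIntegrable_ofReal ((intervalIntegrable_realBesselY a b).const_mul _)).const_mul _)

theorem tendsto_integral_realHankel :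
    Tendsto (fun T => ∫ t in (0 : ℝ)..T, realHankel t) atTop (nhds 1) := by
  have hJ := tendsto_integral_of_bessel_ode (fun t => hasDerivAt_realBesselJ)
    (fun t _ => hasDerivAt_mulDerivBesselJ t) (intervalIntegrable_realBesselJ 0)
    tendsto_struveBracket_besselJ
  have hY := tendsto_integral_of_bessel_ode (fun t => hasDerivAt_realBesselY)
    (fun t => hasDerivAt_mulDerivBesselY) (intervalIntegrable_realBesselY 0)
    tendsto_struveBracket_besselY
  have hJ' := (Complex.continuous_ofReal.tendsto _).comp hJ
  have hY' := ((Complex.continuous_ofReal.tendsto _).comp (hY.const_mul (2 / Real.pi))).const_mul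
    Complex.I
  have h := hJ'.add hY'
  simp only [neg_neg, neg_zero, mul_zero, Complex.ofReal_zero, add_zero, Complex.ofReal_one] at h
  refine h.congr fun T => ?_
  simp only [realHankel, Function.comp_apply]
  rw [intervalIntegral.integral_add (intervalIntegrable_ofReal (intervalIntegrable_realBesselJ 0 T))
      ((intervalIntegrable_ofReal ((intervalIntegrable_realBesselY 0 T).const_mul _)).const_mul _),
    intervalIntegral.integral_const_mul, intervalIntegral.integral_ofReal,
    intervalIntegral.integral_ofReal, intervalIntegral.integral_const_mul]

theorem integral_hankelH_eq {x k : ℝ} (hx : -(1/2) < x) (hx' : x < 1/2) (hk : 0 < k) :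
    ∫ y in (-(1/2) : ℝ)..(1/2), ((k : ℂ) / 2) * hankelH 0 ((k * |x - y| : ℝ) : ℂ) =
      1 / 2 * (∫ t in (0 : ℝ)..(k * (x + 1/2)), realHankel t) +
        1 / 2 * ∫ t in (0 : ℝ)..(k * (1/2 - x)), realHankel t := by
  have hH : ∀ y : ℝ, hankelH 0 ((k * |x - y| : ℝ) : ℂ) = realHankel (k * |x - y|) :=
    fun y => hankelH_zero_ofReal (by positivity)
  have hk' : (k : ℂ) ≠ 0 := by exact_mod_cast hk.ne'
  simp only [hH]
  have e1 : Set.EqOn (fun y => realHankel (k * x - k * y)) (fun y => realHankel (k * |x - y|))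
      (Set.uIcc (-(1/2)) x) := fun y hy => by
    rw [Set.uIcc_of_le hx.le] at hy
    simp only [abs_of_nonneg (sub_nonneg.2 hy.2), mul_sub]
  have e2 : Set.EqOn (fun y => realHankel (k * y - k * x)) (fun y => realHankel (k * |x - y|))
      (Set.uIcc x (1/2)) := fun y hy => by
    rw [Set.uIcc_of_le hx'.le] at hy
    simp only [abs_of_nonpos (sub_nonpos.2 hy.1), neg_sub, mul_sub]
  have i1 : IntervalIntegrable (fun y => realHankel (k * |x - y|)) volume (-(1/2)) x := by
    have h := ((intervalIntegrable_realHankel (k * x - k * -(1/2)) (k * x - k * x)).comp_sub_left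
      (k * x)).comp_mul_left (c := k)
    rw [sub_sub_cancel, sub_sub_cancel, mul_div_cancel_left₀ _ hk.ne',
      mul_div_cancel_left₀ _ hk.ne'] at h
    exact h.congr (e1.mono Set.uIoc_subset_uIcc)
  have i2 : IntervalIntegrable (fun y => realHankel (k * |x - y|)) volume x (1/2) := by
    have h := ((intervalIntegrable_realHankel (k * x - k * x) (k * (1/2) - k * x)).comp_sub_right
      (k * x)).comp_mul_left (c := k)
    rw [sub_add_cancel, sub_add_cancel, mul_div_cancel_left₀ _ hk.ne',
      mul_div_cancel_left₀ _ hk.ne'] at h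
    exact h.congr (e2.mono Set.uIoc_subset_uIcc)
  rw [intervalIntegral.integral_const_mul, ← intervalIntegral.integral_add_adjacent_intervals i1 i2,
    ← intervalIntegral.integral_congr e1, ← intervalIntegral.integral_congr e2,
    intervalIntegral.integral_comp_sub_mul realHankel hk.ne',
    intervalIntegral.integral_comp_mul_sub realHankel hk.ne', sub_self,
    show k * x - k * -(1/2) = k * (x + 1/2) by ring, show k * (1/2) - k * x = k * (1/2 - x) by ring,
    Complex.real_smul, Complex.real_smul]
  push_cast
  field_simp

/-- for every `x ∈ (-1/2, 1/2)`,
`lim_{k→∞} ∫_{-1/2}^{1/2} (k/2) H_0(k|x-y|) dy = 1`. -/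
theorem stmt14 (x : ℝ) (hx : -(1/2) < x) (hx' : x < 1/2) :
    Tendsto (fun k : ℝ => ∫ y in (-(1/2) : ℝ)..(1/2),
        ((k : ℂ) / 2) * hankelH 0 ((k * |x - y| : ℝ) : ℂ))
      atTop (nhds 1) := by
  have h1 := tendsto_integral_realHankel.comp
    (tendsto_id.atTop_mul_const (show 0 < x + 1/2 by linarith))
  have h2 := tendsto_integral_realHankel.comp
    (tendsto_id.atTop_mul_const (show 0 < 1/2 - x by linarith))
  have h := (h1.const_mul (1 / 2)).add (h2.const_mul (1 / 2))
  rw [show (1 / 2 * 1 + 1 / 2 * 1 : ℂ) = 1 by norm_num] at h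
  refine h.congr' ?_
  filter_upwards [eventually_gt_atTop 0] with k hk
  exact (integral_hankelH_eq hx hx' hk).symm
end
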